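/- arXiv:2002.10589 — 3 statements merged into one kernel-verified Lean document; each statement's English description precedes it below -/
import Mathlib

section
/- Let g ≥ 3 and d ≥ 2 be integers and A an abelian group, and set A_d = {a ∈ A : d·a = 0}. Then the map Θ sending x ∈ A_d to the homomorphism 𝔰𝔭_{2g}(ℤ/dℤ) → A, X ↦ tr(α_X)·x (where α_X is the upper-left g×g block of X and tr(α_X) ∈ ℤ/dℤ acts on the d-torsion element x via any integer lift), is an injective group homomorphism whose image is exactly the set of GL_g(ℤ)-invariant homomorphisms; that is, Θ : A_d → Hom(𝔰𝔭_{2g}(ℤ/dℤ), A)^{GL_g(ℤ)} is a group isomorphism. -/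
open Matrix

/-- The standard symplectic matrix `Ω = (0, I_g; −I_g, 0)`. -/
def OmegaMat (g : ℕ) (R : Type*) [Ring R] :
    Matrix (Fin g ⊕ Fin g) (Fin g ⊕ Fin g) R :=
  Matrix.fromBlocks 0 1 (-1) 0

/-- `𝔰𝔭_{2g}(ℤ/dℤ)`: the additive group of `2g × 2g` matrices `X` over `ℤ/dℤ`
satisfying `ᵗX·Ω + Ω·X = 0`. -/
def spLie (g d : ℕ) :
    AddSubgroup (Matrix (Fin g ⊕ Fin g) (Fin g ⊕ Fin g) (ZMod d)) where
  carrier := {X | Xᵀ * OmegaMat g (ZMod d) + OmegaMat g (ZMod d) * X = 0}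
  zero_mem' := by simp
  add_mem' := by
    intro a b ha hb
    simp only [Set.mem_setOf_eq] at *
    rw [transpose_add, add_mul, mul_add]
    calc aᵀ * OmegaMat g (ZMod d) + bᵀ * OmegaMat g (ZMod d) +
          (OmegaMat g (ZMod d) * a + OmegaMat g (ZMod d) * b)
        = (aᵀ * OmegaMat g (ZMod d) + OmegaMat g (ZMod d) * a) +
          (bᵀ * OmegaMat g (ZMod d) + OmegaMat g (ZMod d) * b) := by abel
      _ = 0 := by rw [ha, hb, add_zero]
  neg_mem' := by
    intro a ha
    simp only [Set.mem_setOf_eq] at *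
    rw [transpose_neg, neg_mul, mul_neg, ← neg_add, ha, neg_zero]

/-- The reduction modulo `d` of the block-diagonal matrix `diag(G, ᵗG⁻¹)`,
for `G ∈ GL_g(ℤ)`. -/
def redM (g d : ℕ) (G : GL (Fin g) ℤ) :
    Matrix (Fin g ⊕ Fin g) (Fin g ⊕ Fin g) (ZMod d) :=
  Matrix.fromBlocks
    ((G : Matrix (Fin g) (Fin g) ℤ).map (Int.cast : ℤ → ZMod d)) 0 0
    (((↑(G⁻¹) : Matrix (Fin g) (Fin g) ℤ)ᵀ).map (Int.cast : ℤ → ZMod d))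

/-- A homomorphism `f : 𝔰𝔭_{2g}(ℤ/dℤ) → A` is `GL_g(ℤ)`-invariant if
`f(M·X·M⁻¹) = f(X)` for every `G ∈ GL_g(ℤ)`, where `M` is the reduction modulo `d`
of `diag(G, ᵗG⁻¹)`. -/
def GLInvariant (g d : ℕ) {A : Type*} [AddCommGroup A] (f : ↥(spLie g d) →+ A) : Prop :=
  ∀ (G : GL (Fin g) ℤ) (X Y : ↥(spLie g d)),
    (Y : Matrix (Fin g ⊕ Fin g) (Fin g ⊕ Fin g) (ZMod d)) =
      redM g d G * (X : Matrix (Fin g ⊕ Fin g) (Fin g ⊕ Fin g) (ZMod d)) * (redM g d G)⁻¹ →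
    f Y = f X

/-- The subgroup `A_d = {a ∈ A : d·a = 0}` of `d`-torsion elements. -/
def torsionSub (d : ℕ) (A : Type*) [AddCommGroup A] : AddSubgroup A where
  carrier := {a | d • a = 0}
  zero_mem' := smul_zero d
  add_mem' := by
    intro a b ha hb
    simp only [Set.mem_setOf_eq] at *
    rw [smul_add, ha, hb, add_zero]
  neg_mem' := by
    intro a ha
    simp only [Set.mem_setOf_eq] at *
    rw [smul_neg, ha, neg_zero]

namespace SpAux

/-- Symmetric matrices. -/
def symSub (g d : ℕ) : AddSubgroup (Matrix (Fin g) (Fin g) (ZMod d)) where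
  carrier := {X | Xᵀ = X}
  zero_mem' := by simp
  add_mem' := by
    intro a b ha hb
    simp only [Set.mem_setOf_eq] at *
    rw [transpose_add, ha, hb]
  neg_mem' := by
    intro a ha
    simp only [Set.mem_setOf_eq] at *
    rw [transpose_neg, ha]

theorem mem_spLie {g d : ℕ} (α β γ δ : Matrix (Fin g) (Fin g) (ZMod d)) :
    fromBlocks α β γ δ ∈ spLie g d ↔ βᵀ = β ∧ γᵀ = γ ∧ δ = -αᵀ := by
  change (fromBlocks α β γ δ)ᵀ * OmegaMat g (ZMod d) + OmegaMat g (ZMod d) * fromBlocks α β γ δ = 0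
    ↔ _
  rw [OmegaMat, fromBlocks_transpose, fromBlocks_multiply, fromBlocks_multiply, fromBlocks_add,
    ← fromBlocks_zero, fromBlocks_inj]
  simp only [mul_zero, mul_one, zero_mul, one_mul, mul_neg, neg_mul, zero_add, add_zero]
  constructor
  · rintro ⟨h1, h2, h3, h4⟩
    refine ⟨?_, ?_, ?_⟩
    · rwa [← sub_eq_add_neg, sub_eq_zero] at h4
    · rw [neg_add_eq_zero] at h1; exact h1
    · rw [add_comm] at h2; exact eq_neg_of_add_eq_zero_left h2
  · rintro ⟨h1, h2, h3⟩
    subst h3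
    refine ⟨by rw [h2]; simp, by simp, by simp, by rw [h1]; simp⟩

/-- the α part -/
def aHom (g d : ℕ) : Matrix (Fin g) (Fin g) (ZMod d) →+ spLie g d where
  toFun α := ⟨fromBlocks α 0 0 (-αᵀ), by rw [mem_spLie]; simp⟩
  map_zero' := by ext1; simp
  map_add' x y := by
    ext1
    rw [AddSubgroup.coe_add]
    simp only [fromBlocks_add, transpose_add, neg_add, add_zero]

/-- the β part -/
def bHom (g d : ℕ) : symSub g d →+ spLie g d where
  toFun β := ⟨fromBlocks 0 β 0 0, by rw [mem_spLie]; exact ⟨β.2, by simp, by simp⟩⟩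
  map_zero' := by ext1; simp
  map_add' x y := by
    ext1
    simp [fromBlocks_add]

/-- the γ part -/
def cHom (g d : ℕ) : symSub g d →+ spLie g d where
  toFun β := ⟨fromBlocks 0 0 β 0, by rw [mem_spLie]; exact ⟨by simp, β.2, by simp⟩⟩
  map_zero' := by ext1; simp
  map_add' x y := by
    ext1
    simp [fromBlocks_add]

theorem decomp {g d : ℕ} (X : spLie g d) : ∃ (β γ : symSub g d),
    X = aHom g d (X : Matrix (Fin g ⊕ Fin g) (Fin g ⊕ Fin g) (ZMod d)).toBlocks₁₁
      + bHom g d β + cHom g d γ := by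
  obtain ⟨X, hX⟩ := X
  have h := hX
  rw [← fromBlocks_toBlocks X, mem_spLie] at h
  refine ⟨⟨_, h.1⟩, ⟨_, h.2.1⟩, ?_⟩
  ext1
  simp only [aHom, bHom, cHom, AddMonoidHom.coe_mk, ZeroHom.coe_mk, AddSubgroup.coe_add,
    fromBlocks_add, add_zero, zero_add, ← h.2.2]
  rw [fromBlocks_toBlocks]

/-- reduction mod d of G -/
abbrev red {g : ℕ} (d : ℕ) (G : GL (Fin g) ℤ) : Matrix (Fin g) (Fin g) (ZMod d) :=
  (G : Matrix (Fin g) (Fin g) ℤ).map (Int.cast : ℤ → ZMod d)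

theorem red_mul {g d : ℕ} (G H : GL (Fin g) ℤ) : red d (G * H) = red d G * red d H := by
  have := Matrix.map_mul (L := (G : Matrix (Fin g) (Fin g) ℤ)) (M := (H : Matrix (Fin g) (Fin g) ℤ))
    (f := Int.castRingHom (ZMod d))
  exact this

theorem red_one {g d : ℕ} : red d (1 : GL (Fin g) ℤ) = 1 := by
  simp [red]

theorem red_inv {g d : ℕ} (G : GL (Fin g) ℤ) : red d G * red d G⁻¹ = 1 := by
  rw [← red_mul, mul_inv_cancel, red_one]

theorem red_inv' {g d : ℕ} (G : GL (Fin g) ℤ) : red d G⁻¹ * red d G = 1 := by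
  rw [← red_mul, inv_mul_cancel, red_one]

theorem redM_eq {g d : ℕ} (G : GL (Fin g) ℤ) :
    redM g d G = fromBlocks (red d G) 0 0 (red d G⁻¹)ᵀ := rfl

theorem redM_inv {g d : ℕ} (G : GL (Fin g) ℤ) :
    (redM g d G)⁻¹ = fromBlocks (red d G⁻¹) 0 0 (red d G)ᵀ := by
  apply inv_eq_right_inv
  rw [redM_eq, fromBlocks_multiply]
  simp only [mul_zero, zero_mul, add_zero, zero_add, ← transpose_mul, red_inv, transpose_one,
    fromBlocks_one]

theorem conj_eq {g d : ℕ} (G : GL (Fin g) ℤ) (α β γ δ : Matrix (Fin g) (Fin g) (ZMod d)) :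
    redM g d G * fromBlocks α β γ δ * (redM g d G)⁻¹ =
    fromBlocks (red d G * α * red d G⁻¹) (red d G * β * (red d G)ᵀ)
      ((red d G⁻¹)ᵀ * γ * red d G⁻¹) ((red d G⁻¹)ᵀ * δ * (red d G)ᵀ) := by
  rw [redM_inv, redM_eq, fromBlocks_multiply, fromBlocks_multiply]
  simp

/-- transvection in GL -/
def tv {g : ℕ} (i j : Fin g) (h : i ≠ j) (c : ℤ) : GL (Fin g) ℤ where
  val := transvection i j c
  inv := transvection i j (-c)
  val_inv := by rw [transvection_mul_transvection_same _ _ h]; simp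
  inv_val := by rw [transvection_mul_transvection_same _ _ h]; simp

theorem red_tv {g d : ℕ} (i j : Fin g) (h : i ≠ j) (c : ℤ) :
    red d (tv i j h c) = transvection i j (c : ZMod d) := by
  ext a b
  simp only [red, tv, map_apply, transvection, Matrix.add_apply, one_apply, single_apply]
  split_ifs <;> simp

theorem red_tv_inv {g d : ℕ} (i j : Fin g) (h : i ≠ j) (c : ℤ) :
    red d (tv i j h c)⁻¹ = transvection i j (-c : ZMod d) := by
  have : (tv i j h c)⁻¹ = tv i j h (-c) := by ext1; rfl
  rw [this, red_tv]; simp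

theorem inv_a {g d : ℕ} {A : Type*} [AddCommGroup A] {f : spLie g d →+ A}
    (hf : GLInvariant g d f) (i j : Fin g) (h : i ≠ j) (α : Matrix (Fin g) (Fin g) (ZMod d)) :
    f (aHom g d (transvection i j 1 * α * transvection i j (-1))) = f (aHom g d α) := by
  apply hf (tv i j h 1)
  simp only [aHom, AddMonoidHom.coe_mk, ZeroHom.coe_mk]
  rw [conj_eq, red_tv, red_tv_inv]
  simp [transpose_mul, Matrix.mul_assoc]

theorem sym_conj {g d : ℕ} (P : Matrix (Fin g) (Fin g) (ZMod d)) (β : symSub g d) :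
    P * (β : Matrix (Fin g) (Fin g) (ZMod d)) * Pᵀ ∈ symSub g d := by
  have h : (β : Matrix (Fin g) (Fin g) (ZMod d))ᵀ = β := β.2
  change (_)ᵀ = _
  simp [transpose_mul, Matrix.mul_assoc, h]

theorem tv_transpose {g d : ℕ} (i j : Fin g) (c : ZMod d) :
    (transvection i j c)ᵀ = transvection j i c := by
  simp [transvection]

theorem inv_b {g d : ℕ} {A : Type*} [AddCommGroup A] {f : spLie g d →+ A}
    (hf : GLInvariant g d f) (i j : Fin g) (h : i ≠ j) (β : symSub g d) :
    f (bHom g d ⟨_, sym_conj (transvection i j 1) β⟩) = f (bHom g d β) := by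
  apply hf (tv i j h 1)
  simp only [bHom, AddMonoidHom.coe_mk, ZeroHom.coe_mk]
  rw [conj_eq, red_tv, red_tv_inv]
  simp

theorem inv_c {g d : ℕ} {A : Type*} [AddCommGroup A] {f : spLie g d →+ A}
    (hf : GLInvariant g d f) (i j : Fin g) (h : i ≠ j) (β : symSub g d) :
    f (cHom g d ⟨_, sym_conj (transvection i j 1) β⟩) = f (cHom g d β) := by
  apply hf (tv j i h.symm (-1))
  simp only [cHom, AddMonoidHom.coe_mk, ZeroHom.coe_mk]
  rw [conj_eq, red_tv, red_tv_inv]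
  simp [tv_transpose]

theorem exists_third {g : ℕ} (hg : 3 ≤ g) (i k : Fin g) : ∃ j, j ≠ i ∧ j ≠ k := by
  have : ({i, k} : Finset (Fin g)).card < Fintype.card (Fin g) := by
    have := Finset.card_le_two (a := i) (b := k)
    simp; omega
  obtain ⟨j, hj⟩ := Finset.exists_mem_notMem_of_card_lt_card
    (s := ({i, k} : Finset (Fin g))) (t := Finset.univ) (by simpa using this)
  exact ⟨j, by simpa using hj.2⟩

section
variable {g d : ℕ} {A : Type*} [AddCommGroup A]

theorem a_off (hg : 3 ≤ g) (φ : Matrix (Fin g) (Fin g) (ZMod d) →+ A)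
    (h : ∀ i j, i ≠ j → ∀ α, φ (transvection i j 1 * α * transvection i j (-1)) = φ α)
    (i k : Fin g) (hik : i ≠ k) (s : ZMod d) : φ (single i k s) = 0 := by
  obtain ⟨j, hji, hjk⟩ := exists_third hg i k
  have := h i j hji.symm (single j k s)
  have e : transvection i j 1 * single j k s * transvection i j (-1)
      = single j k s + single i k s := by
    simp [transvection, add_mul, mul_add, hik.symm]
  rw [e, map_add] at this
  simpa using this

theorem a_diag (hg : 3 ≤ g) (φ : Matrix (Fin g) (Fin g) (ZMod d) →+ A)
    (h : ∀ i j, i ≠ j → ∀ α, φ (transvection i j 1 * α * transvection i j (-1)) = φ α)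
    (i j : Fin g) (s : ZMod d) : φ (single i i s) = φ (single j j s) := by
  by_cases hij : i = j
  · rw [hij]
  have := h i j hij (single j i s)
  have e : transvection i j 1 * single j i s * transvection i j (-1)
      = single j i s + single i i s - single j j s - single i j s := by
    simp [transvection, add_mul, mul_add]
    rw [← single_neg, ← single_neg]
    abel
  rw [e, map_sub, map_sub, map_add, a_off hg φ h j i (Ne.symm hij), a_off hg φ h i j hij] at this
  simpa [sub_eq_zero] using this

theorem a_main (hg : 3 ≤ g) (φ : Matrix (Fin g) (Fin g) (ZMod d) →+ A)
    (h : ∀ i j, i ≠ j → ∀ α, φ (transvection i j 1 * α * transvection i j (-1)) = φ α)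
    (k : Fin g) (α) : φ α = φ (single k k (trace α)) := by
  conv_lhs => rw [matrix_eq_sum_single α]
  rw [map_sum]
  have : ∀ i, φ (∑ j, single i j (α i j)) = φ (single k k (α i i)) := by
    intro i
    rw [map_sum, Finset.sum_eq_single i]
    · exact a_diag hg φ h i k _
    · intro j _ hj
      exact a_off hg φ h i j (Ne.symm hj) _
    · simp
  rw [Finset.sum_congr rfl (fun i _ => this i), ← map_sum]
  congr 1
  simp only [trace, diag]
  exact (map_sum (singleAddMonoidHom k k) (fun i => α i i) Finset.univ).symm

/-- N + Nᵀ -/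
def symm2 (g d : ℕ) : Matrix (Fin g) (Fin g) (ZMod d) →+ symSub g d where
  toFun N := ⟨N + Nᵀ, by change (_)ᵀ = _; simp [add_comm]⟩
  map_zero' := by ext1; simp
  map_add' x y := by ext1; simp; abel

/-- diagonal -/
def dg (i : Fin g) : ZMod d →+ symSub g d where
  toFun s := ⟨single i i s, by change (_)ᵀ = _; simp⟩
  map_zero' := by ext1; simp
  map_add' x y := by ext1; simp [single_add]

theorem s_off (hg : 3 ≤ g) (F : symSub g d →+ A)
    (h : ∀ i j, i ≠ j → ∀ β, F ⟨_, sym_conj (transvection i j 1) β⟩ = F β)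
    (i k : Fin g) (hik : i ≠ k) (s : ZMod d) : F (symm2 g d (single i k s)) = 0 := by
  obtain ⟨j, hji, hjk⟩ := exists_third hg i k
  have := h i j hji.symm (symm2 g d (single j k s))
  have e : (⟨_, sym_conj (transvection i j 1) (symm2 g d (single j k s))⟩ : symSub g d)
      = symm2 g d (single j k s) + symm2 g d (single i k s) := by
    ext1
    simp [symm2, tv_transpose]
    simp [transvection, add_mul, mul_add, hjk, hjk.symm]
    abel
  rw [e, map_add] at this
  simpa using this

theorem s_diag (hg : 3 ≤ g) (F : symSub g d →+ A)
    (h : ∀ i j, i ≠ j → ∀ β, F ⟨_, sym_conj (transvection i j 1) β⟩ = F β)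
    (i : Fin g) (s : ZMod d) : F (dg i s) = 0 := by
  obtain ⟨j, hji, -⟩ := exists_third hg i i
  have := h i j hji.symm (dg j s)
  have e : (⟨_, sym_conj (transvection i j 1) (dg j s)⟩ : symSub g d)
      = dg j s + dg i s + symm2 g d (single i j s) := by
    ext1
    simp [symm2, dg, tv_transpose]
    simp [transvection, add_mul, mul_add]
    abel
  rw [e, map_add, map_add, s_off hg F h i j hji.symm] at this
  simpa using this

theorem s_main (hg : 3 ≤ g) (F : symSub g d →+ A)
    (h : ∀ i j, i ≠ j → ∀ β, F ⟨_, sym_conj (transvection i j 1) β⟩ = F β)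
    (β : symSub g d) : F β = 0 := by
  let N : Matrix (Fin g) (Fin g) (ZMod d) :=
    Matrix.of fun i j => if i < j then (β : Matrix (Fin g) (Fin g) (ZMod d)) i j else 0
  have hβ : ∀ a b, (β : Matrix (Fin g) (Fin g) (ZMod d)) a b = β.1 b a := fun a b =>
    congrFun (congrFun (β.2 : (β.1)ᵀ = β.1) b) a
  have e : β = ∑ i, dg i ((β : Matrix (Fin g) (Fin g) (ZMod d)) i i) + symm2 g d N := by
    ext1
    have : ∀ i, ((dg i ((β : Matrix (Fin g) (Fin g) (ZMod d)) i i) : symSub g d) :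
      Matrix (Fin g) (Fin g) (ZMod d)) = single i i (β.1 i i) := fun i => rfl
    rw [AddSubgroup.coe_add, AddSubgroup.val_finset_sum]
    simp only [this]
    ext a b
    have h2 : (symm2 g d N : Matrix (Fin g) (Fin g) (ZMod d)) = N + Nᵀ := rfl
    rw [h2, Matrix.add_apply, Matrix.add_apply, Matrix.sum_apply, transpose_apply]
    simp only [N, of_apply, single_apply]
    rcases lt_trichotomy a b with hl | hl | hl
    · have : ∀ x, ¬ (x = a ∧ x = b) := by rintro x ⟨rfl, rfl⟩; exact lt_irrefl _ hl
      simp [this, hl, hl.not_gt]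
    · subst hl
      simp
    · have : ∀ x, ¬ (x = a ∧ x = b) := by rintro x ⟨rfl, rfl⟩; exact lt_irrefl _ hl
      simp [this, hl, hl.not_gt]
      exact hβ a b
  rw [e, map_add, map_sum, matrix_eq_sum_single N]
  simp only [map_sum, s_diag hg F h, Finset.sum_const_zero, zero_add]
  refine Finset.sum_eq_zero fun i _ => Finset.sum_eq_zero fun j _ => ?_
  by_cases hij : i = j
  · subst hij
    simp [N]
  · exact s_off hg F h i j hij _

theorem mod_smul (x : A) (hx : d • x = 0) (n : ℕ) : (n % d) • x = n • x := by
  conv_rhs => rw [← Nat.mod_add_div n d]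
  rw [add_smul, mul_comm, mul_smul, hx, smul_zero, add_zero]

/-- The hom Θ x. -/
def theta [NeZero d] (x : torsionSub d A) : spLie g d →+ A where
  toFun X := (trace ((X : Matrix (Fin g ⊕ Fin g) (Fin g ⊕ Fin g) (ZMod d)).toBlocks₁₁)).val • (x : A)
  map_zero' := by
    have : ((0 : spLie g d) : Matrix (Fin g ⊕ Fin g) (Fin g ⊕ Fin g) (ZMod d)).toBlocks₁₁ = 0 := rfl
    rw [this]; simp
  map_add' X Y := by
    have : ((X + Y : spLie g d) : Matrix (Fin g ⊕ Fin g) (Fin g ⊕ Fin g) (ZMod d)).toBlocks₁₁ =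
      X.1.toBlocks₁₁ + Y.1.toBlocks₁₁ := rfl
    rw [this, trace_add, ZMod.val_add, mod_smul _ x.2, add_smul]

end

end SpAux

theorem sp_invariant_homs_eq_torsion (g d : ℕ) (hg : 3 ≤ g) (hd : 2 ≤ d)
    (A : Type*) [AddCommGroup A] :
    ∃ Θ : ↥(torsionSub d A) → (↥(spLie g d) →+ A),
      -- `Θ x` sends `X` to `tr(α_X)·x`, where `α_X` is the upper-left `g×g` block of `X`
      -- and the trace acts via its integer (here: natural number) lift
      (∀ x X, Θ x X =
        (Matrix.trace ((X : Matrix (Fin g ⊕ Fin g) (Fin g ⊕ Fin g) (ZMod d)).toBlocks₁₁)).val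
          • (x : A)) ∧
      -- `Θ` is an (injective) group homomorphism …
      (∀ x y, Θ (x + y) = Θ x + Θ y) ∧
      Function.Injective Θ ∧
      -- … whose image is exactly the set of `GL_g(ℤ)`-invariant homomorphisms
      (∀ x, GLInvariant g d (Θ x)) ∧
      (∀ f : ↥(spLie g d) →+ A, GLInvariant g d f → ∃ x, Θ x = f) := by
  haveI : NeZero d := ⟨by omega⟩
  haveI : Fact (1 < d) := ⟨by omega⟩
  let k : Fin g := ⟨0, by omega⟩
  have htr : ∀ t : ZMod d, trace ((SpAux.aHom g d (single k k t) :
      Matrix (Fin g ⊕ Fin g) (Fin g ⊕ Fin g) (ZMod d)).toBlocks₁₁) = t := by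
    intro t
    simp [SpAux.aHom]
  refine ⟨SpAux.theta, fun x X => rfl, ?_, ?_, ?_, ?_⟩
  · intro x y
    ext X
    exact smul_add _ _ _
  · intro x y hxy
    have h := DFunLike.congr_fun hxy (SpAux.aHom g d (single k k 1))
    simp only [SpAux.theta, AddMonoidHom.coe_mk, ZeroHom.coe_mk, htr, ZMod.val_one, one_smul] at h
    exact Subtype.ext h
  · intro x G X Y hY
    simp only [SpAux.theta, AddMonoidHom.coe_mk, ZeroHom.coe_mk]
    congr 2
    rw [hY, ← fromBlocks_toBlocks X.1, SpAux.conj_eq, toBlocks_fromBlocks₁₁,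
      toBlocks_fromBlocks₁₁, trace_mul_comm, ← Matrix.mul_assoc, SpAux.red_inv', Matrix.one_mul]
  · intro f hf
    let u : ZMod d →+ A := (f.comp (SpAux.aHom g d)).comp (singleAddMonoidHom k k)
    have hu : ∀ t, u t = t.val • u 1 := by
      intro t
      rw [← map_nsmul]
      simp
    have hx : u 1 ∈ torsionSub d A := by
      change d • u 1 = 0
      rw [← map_nsmul]
      simp
    refine ⟨⟨u 1, hx⟩, ?_⟩
    ext X
    obtain ⟨β, γ, hX⟩ := SpAux.decomp X
    have ha := SpAux.a_main hg (f.comp (SpAux.aHom g d))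
      (fun i j h α => SpAux.inv_a hf i j h α) k X.1.toBlocks₁₁
    have hb := SpAux.s_main hg (f.comp (SpAux.bHom g d))
      (fun i j h α => SpAux.inv_b hf i j h α) β
    have hc := SpAux.s_main hg (f.comp (SpAux.cHom g d))
      (fun i j h α => SpAux.inv_c hf i j h α) γ
    simp only [AddMonoidHom.comp_apply] at ha hb hc
    have : f X = u (trace X.1.toBlocks₁₁) := by
      conv_lhs => rw [hX]
      rw [map_add, map_add, hb, hc, ha, add_zero, add_zero]
      rfl
    rw [this]
    exact (hu _).symm
end

section
/- Let p be an odd prime and g ≥ 3. Let H_p = (ℤ/pℤ)^{2g} with standard basis a_1,…,a_g,b_1,…,b_g, and for G ∈ GL_g(ℤ) let φ_G be the automorphism of H_p given by the reduction modulo p of the block-diagonal matrix diag(G, ᵗG⁻¹). Then the set of ℤ/pℤ-bilinear maps B : ⋀³H_p × ⋀³H_p → ℤ/pℤ that are alternating (B(u,u) = 0 for all u) and satisfy B(⋀³φ_G(u), ⋀³φ_G(v)) = B(u,v) for all G ∈ GL_g(ℤ) and all u, v ∈ ⋀³H_p is a ℤ/pℤ-vector space of dimension 3; equivalently, it has exactly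 p³ elements. -/
open Matrix

theorem exteriorPower_map_mem {R : Type*} [CommRing R] {M N : Type*} [AddCommGroup M]
    [Module R M] [AddCommGroup N] [Module R N] (f : M →ₗ[R] N) (n : ℕ)
    {x : ExteriorAlgebra R M} (hx : x ∈ ⋀[R]^n M) :
    ExteriorAlgebra.map f x ∈ ⋀[R]^n N := by
  have h1 : Submodule.map (ExteriorAlgebra.map f).toLinearMap (⋀[R]^n M) ≤ ⋀[R]^n N := by
    rw [ExteriorAlgebra.exteriorPower, ExteriorAlgebra.exteriorPower, Submodule.map_pow,
      ExteriorAlgebra.ι_range_map_map]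
    refine pow_le_pow_left' ?_ n
    rw [LinearMap.range_eq_map (ExteriorAlgebra.ι R)]
    exact Submodule.map_mono le_top
  exact h1 ⟨x, hx, rfl⟩

/-- The linear map `⋀[R]^n M →ₗ[R] ⋀[R]^n N` induced by a linear map `f : M →ₗ[R] N`
(sending `u₁ ∧ ⋯ ∧ uₙ` to `f u₁ ∧ ⋯ ∧ f uₙ`). -/
noncomputable def extPowerMap {R : Type*} [CommRing R] {M N : Type*} [AddCommGroup M]
    [Module R M] [AddCommGroup N] [Module R N] (n : ℕ) (f : M →ₗ[R] N) :
    (⋀[R]^n M) →ₗ[R] (⋀[R]^n N) :=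
  (ExteriorAlgebra.map f).toLinearMap.restrict fun _ hx => exteriorPower_map_mem f n hx

/-- `H_p = (ℤ/pℤ)^{2g}`, split as the span of `a_1, …, a_g` (first factor) and of
`b_1, …, b_g` (second factor). -/
abbrev Hsp (p g : ℕ) := (Fin g → ZMod p) × (Fin g → ZMod p)

/-- For `G ∈ GL_g(ℤ)`, the automorphism of `H_p` given by the reduction modulo `p`
of the block-diagonal matrix `diag(G, ᵗG⁻¹)`. -/
noncomputable def phiGp (p g : ℕ) (G : GL (Fin g) ℤ) : Hsp p g →ₗ[ZMod p] Hsp p g :=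
  LinearMap.prodMap
    (Matrix.toLin' ((G : Matrix (Fin g) (Fin g) ℤ).map (Int.cast : ℤ → ZMod p)))
    (Matrix.toLin' (((↑(G⁻¹) : Matrix (Fin g) (Fin g) ℤ)ᵀ).map (Int.cast : ℤ → ZMod p)))


section Combinatorics

/-- The sign of the index `k` under the reflection at `v`. -/
def sgnAt {ι : Type*} [DecidableEq ι] (v k : ι) : ℤ := if k = v then -1 else 1

theorem sgnAt_self {ι : Type*} [DecidableEq ι] (v : ι) : sgnAt v v = -1 := by simp [sgnAt]

theorem sgnAt_ne {ι : Type*} [DecidableEq ι] {v k : ι} (h : k ≠ v) : sgnAt v k = 1 := by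
  simp [sgnAt, h]

theorem sgnAt_sq {ι : Type*} [DecidableEq ι] (v k : ι) : sgnAt v k * sgnAt v k = 1 := by
  unfold sgnAt; split_ifs <;> norm_num

theorem match_two {ι : Type*} [DecidableEq ι] (i j : ι)
    (h : ∀ v, sgnAt v i * sgnAt v j ≠ -1) : i = j := by
  by_contra hij
  apply h i
  rw [sgnAt_self, sgnAt_ne (Ne.symm hij)]; norm_num

theorem match_four {ι : Type*} [DecidableEq ι] (i j k l : ι)
    (h : ∀ v, sgnAt v i * sgnAt v j * sgnAt v k * sgnAt v l ≠ -1) :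
    (i = j ∧ k = l) ∨ (i = k ∧ j = l) ∨ (i = l ∧ j = k) := by
  by_cases h1 : i = j
  · subst h1
    refine Or.inl ⟨rfl, match_two _ _ fun v => ?_⟩
    have := h v
    have e := sgnAt_sq v i
    intro h'; apply this; linear_combination sgnAt v k * sgnAt v l * e + h'
  by_cases h2 : i = k
  · subst h2
    refine Or.inr (Or.inl ⟨rfl, match_two _ _ fun v => ?_⟩)
    have := h v
    have e := sgnAt_sq v i
    intro h'; apply this; linear_combination sgnAt v j * sgnAt v l * e + h'
  by_cases h3 : i = l
  · subst h3
    refine Or.inr (Or.inr ⟨rfl, match_two _ _ fun v => ?_⟩)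
    have := h v
    have e := sgnAt_sq v i
    intro h'; apply this; linear_combination sgnAt v j * sgnAt v k * e + h'
  exfalso
  apply h i
  rw [sgnAt_self, sgnAt_ne (Ne.symm h1), sgnAt_ne (Ne.symm h2), sgnAt_ne (Ne.symm h3)]; norm_num

theorem match_six {ι : Type*} [DecidableEq ι] (i j k l m n : ι)
    (h : ∀ v, sgnAt v i * sgnAt v j * sgnAt v k * sgnAt v l * sgnAt v m * sgnAt v n ≠ -1) :
    (i = j ∧ ((k = l ∧ m = n) ∨ (k = m ∧ l = n) ∨ (k = n ∧ l = m))) ∨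
    (i = k ∧ ((j = l ∧ m = n) ∨ (j = m ∧ l = n) ∨ (j = n ∧ l = m))) ∨
    (i = l ∧ ((j = k ∧ m = n) ∨ (j = m ∧ k = n) ∨ (j = n ∧ k = m))) ∨
    (i = m ∧ ((j = k ∧ l = n) ∨ (j = l ∧ k = n) ∨ (j = n ∧ k = l))) ∨
    (i = n ∧ ((j = k ∧ l = m) ∨ (j = l ∧ k = m) ∨ (j = m ∧ k = l))) := by
  by_cases h1 : i = j
  · subst h1
    refine Or.inl ⟨rfl, match_four _ _ _ _ fun v => ?_⟩
    have := h v
    have e := sgnAt_sq v i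
    intro h'; apply this
    linear_combination sgnAt v k * sgnAt v l * sgnAt v m * sgnAt v n * e + h'
  by_cases h2 : i = k
  · subst h2
    refine Or.inr (Or.inl ⟨rfl, match_four _ _ _ _ fun v => ?_⟩)
    have := h v
    have e := sgnAt_sq v i
    intro h'; apply this
    linear_combination sgnAt v j * sgnAt v l * sgnAt v m * sgnAt v n * e + h'
  by_cases h3 : i = l
  · subst h3
    refine Or.inr (Or.inr (Or.inl ⟨rfl, match_four _ _ _ _ fun v => ?_⟩))
    have := h v
    have e := sgnAt_sq v i
    intro h'; apply this
    linear_combination sgnAt v j * sgnAt v k * sgnAt v m * sgnAt v n * e + h'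
  by_cases h4 : i = m
  · subst h4
    refine Or.inr (Or.inr (Or.inr (Or.inl ⟨rfl, match_four _ _ _ _ fun v => ?_⟩)))
    have := h v
    have e := sgnAt_sq v i
    intro h'; apply this
    linear_combination sgnAt v j * sgnAt v k * sgnAt v l * sgnAt v n * e + h'
  by_cases h5 : i = n
  · subst h5
    refine Or.inr (Or.inr (Or.inr (Or.inr ⟨rfl, match_four _ _ _ _ fun v => ?_⟩)))
    have := h v
    have e := sgnAt_sq v i
    intro h'; apply this
    linear_combination sgnAt v j * sgnAt v k * sgnAt v l * sgnAt v m * e + h'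
  exfalso
  apply h i
  rw [sgnAt_self, sgnAt_ne (Ne.symm h1), sgnAt_ne (Ne.symm h2), sgnAt_ne (Ne.symm h3),
    sgnAt_ne (Ne.symm h4), sgnAt_ne (Ne.symm h5)]
  norm_num

theorem exists_perm_three {g : ℕ} (i j k i' j' k' : Fin g) (hij : i ≠ j) (hik : i ≠ k)
    (hjk : j ≠ k) (hij' : i' ≠ j') (hik' : i' ≠ k') (hjk' : j' ≠ k') :
    ∃ σ : Equiv.Perm (Fin g), σ i = i' ∧ σ j = j' ∧ σ k = k' := by
  classical
  set f : Fin g → Fin g := fun x => if x = i then i' else if x = j then j' else k' with hf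
  obtain ⟨e, he⟩ := Finset.exists_equiv_extend_of_card_eq (α := Fin g) (t := Finset.univ)
    (by simp) (s := {i, j, k}) (f := f) (Finset.subset_univ _) (by
      intro x hx y hy hxy
      simp only [Finset.coe_insert, Finset.coe_singleton, Set.mem_insert_iff,
        Set.mem_singleton_iff] at hx hy
      simp only [hf] at hxy
      grind)
  refine ⟨e.trans (Equiv.subtypeUnivEquiv (by simp)), ?_, ?_, ?_⟩
  · simp [he, hf]
  · simp [he, hf, hij.symm]
  · simp [he, hf, hik.symm, hjk.symm]

end Combinatorics

section Wedge

variable {K V : Type*} [Field K] [AddCommGroup V] [Module K V]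

/-- The decomposable trivector `x ∧ y ∧ z`. -/
noncomputable def wdg (K : Type*) {V : Type*} [Field K] [AddCommGroup V] [Module K V]
    (x y z : V) : ⋀[K]^3 V := exteriorPower.ιMulti K 3 ![x, y, z]

theorem upd_zero {V : Type*} (x y z t : V) : Function.update ![x, y, z] 0 t = ![t, y, z] := by
  ext i; fin_cases i <;> rfl

theorem wdg_add1 (x x' y z : V) : wdg K (x + x') y z = wdg K x y z + wdg K x' y z := by
  have := (exteriorPower.ιMulti K 3).map_update_add ![x, y, z] 0 x x'
  simpa only [wdg, upd_zero] using this

theorem wdg_swap12 (x y z : V) : wdg K y x z = - wdg K x y z := by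
  have := (exteriorPower.ιMulti K 3).map_swap ![x, y, z] (i := 0) (j := 1) (by decide)
  rw [wdg, wdg, ← this]
  congr 1
  ext i; fin_cases i <;> rfl

theorem wdg_swap23 (x y z : V) : wdg K x z y = - wdg K x y z := by
  have := (exteriorPower.ιMulti K 3).map_swap ![x, y, z] (i := 1) (j := 2) (by decide)
  rw [wdg, wdg, ← this]
  congr 1
  ext i; fin_cases i <;> rfl

theorem wdg_smul1 (c : ℤ) (x y z : V) : wdg K (c • x) y z = c • wdg K x y z := by
  have := (exteriorPower.ιMulti K 3).map_update_smul ![x, y, z] 0 (c : K) x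
  simpa only [wdg, upd_zero, Int.cast_smul_eq_zsmul] using this

theorem wdg_z12 (x z : V) : wdg K x x z = 0 :=
  (exteriorPower.ιMulti K 3).map_eq_zero_of_eq ![x, x, z] (i := 0) (j := 1) rfl (by decide)

theorem wdg_z23 (x z : V) : wdg K z x x = 0 :=
  (exteriorPower.ιMulti K 3).map_eq_zero_of_eq ![z, x, x] (i := 1) (j := 2) rfl (by decide)

theorem wdg_z13 (x z : V) : wdg K x z x = 0 :=
  (exteriorPower.ιMulti K 3).map_eq_zero_of_eq ![x, z, x] (i := 0) (j := 2) rfl (by decide)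

theorem wdg_smul2 (c : ℤ) (x y z : V) : wdg K x (c • y) z = c • wdg K x y z := by
  rw [wdg_swap12, wdg_smul1, wdg_swap12, smul_neg, neg_neg]

theorem wdg_smul3 (c : ℤ) (x y z : V) : wdg K x y (c • z) = c • wdg K x y z := by
  rw [wdg_swap23, wdg_smul2, wdg_swap23, smul_neg, neg_neg]

theorem wdg_add2 (x y y' z : V) : wdg K x (y + y') z = wdg K x y z + wdg K x y' z := by
  rw [wdg_swap12, wdg_add1, wdg_swap12 x, wdg_swap12 x, neg_add, neg_neg, neg_neg]

theorem wdg_add3 (x y z z' : V) : wdg K x y (z + z') = wdg K x y z + wdg K x y z' := by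
  rw [wdg_swap23, wdg_add2, wdg_swap23 x y z, wdg_swap23 x y z', neg_add, neg_neg, neg_neg]

theorem wdg_sub1 (x x' y z : V) : wdg K (x - x') y z = wdg K x y z - wdg K x' y z := by
  have := wdg_smul1 (K := K) (-1) x' y z
  simp only [neg_smul, one_smul] at this
  rw [sub_eq_add_neg, wdg_add1, this, sub_eq_add_neg]

theorem wdg_sub2 (x y y' z : V) : wdg K x (y - y') z = wdg K x y z - wdg K x y' z := by
  rw [wdg_swap12, wdg_sub1, wdg_swap12 x, wdg_swap12 x]; abel

theorem wdg_sub3 (x y z zz : V) : wdg K x y (z - zz) = wdg K x y z - wdg K x y zz := by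
  rw [wdg_swap23, wdg_sub2, wdg_swap23 x y z, wdg_swap23 x y zz]; abel

/-- Invariance of a bilinear form under an endomorphism, on decomposable trivectors. -/
def InvUnder (B : (⋀[K]^3 V) →ₗ[K] (⋀[K]^3 V) →ₗ[K] K) (φ : V →ₗ[K] V) : Prop :=
  ∀ x y z u v w, B (wdg K (φ x) (φ y) (φ z)) (wdg K (φ u) (φ v) (φ w)) =
    B (wdg K x y z) (wdg K u v w)

/-- The invariance properties used to determine the form. -/
structure GoodForm {g : ℕ} (a b : Fin g → V)
    (B : (⋀[K]^3 V) →ₗ[K] (⋀[K]^3 V) →ₗ[K] K) : Prop where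
  two_ne : (2 : K) ≠ 0
  alt : ∀ u, B u u = 0
  elem : ∀ i j, i ≠ j → ∃ φ, InvUnder B φ ∧ φ (a j) = a j + a i ∧ φ (b i) = b i - b j ∧
    (∀ k, k ≠ j → φ (a k) = a k) ∧ (∀ k, k ≠ i → φ (b k) = b k)
  elem' : ∀ i j, i ≠ j → ∃ φ, InvUnder B φ ∧ φ (b j) = b j + b i ∧ φ (a i) = a i - a j ∧
    (∀ k, k ≠ j → φ (b k) = b k) ∧ (∀ k, k ≠ i → φ (a k) = a k)
  sgn : ∀ v, ∃ φ, InvUnder B φ ∧ (∀ k, φ (a k) = sgnAt v k • a k) ∧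
    (∀ k, φ (b k) = sgnAt v k • b k)
  perm : ∀ σ : Equiv.Perm (Fin g), ∃ φ, InvUnder B φ ∧ (∀ k, φ (a k) = a (σ k)) ∧
    (∀ k, φ (b k) = b (σ k))

namespace GoodForm

variable {g : ℕ} {a b : Fin g → V} {B : (⋀[K]^3 V) →ₗ[K] (⋀[K]^3 V) →ₗ[K] K}

theorem symm (H : GoodForm a b B) : GoodForm b a B where
  two_ne := H.two_ne
  alt := H.alt
  elem := H.elem'
  elem' := H.elem
  sgn v := by obtain ⟨φ, h1, h2, h3⟩ := H.sgn v; exact ⟨φ, h1, h3, h2⟩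
  perm v := by obtain ⟨φ, h1, h2, h3⟩ := H.perm v; exact ⟨φ, h1, h3, h2⟩

theorem skew (H : GoodForm a b B) (u v) : B u v = - B v u := by
  have := H.alt (u + v)
  simp only [map_add, LinearMap.add_apply, H.alt] at this
  linear_combination this

/-- A basis letter. -/
def letter (a b : Fin g → V) (t : Bool) (i : Fin g) : V := if t then a i else b i

theorem parity (H : GoodForm a b B) (t1 t2 t3 t4 t5 t6 : Bool) (i j k l m n : Fin g)
    (h0 : B (wdg K (letter a b t1 i) (letter a b t2 j) (letter a b t3 k))
      (wdg K (letter a b t4 l) (letter a b t5 m) (letter a b t6 n)) ≠ 0) :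
    (i = j ∧ ((k = l ∧ m = n) ∨ (k = m ∧ l = n) ∨ (k = n ∧ l = m))) ∨
    (i = k ∧ ((j = l ∧ m = n) ∨ (j = m ∧ l = n) ∨ (j = n ∧ l = m))) ∨
    (i = l ∧ ((j = k ∧ m = n) ∨ (j = m ∧ k = n) ∨ (j = n ∧ k = m))) ∨
    (i = m ∧ ((j = k ∧ l = n) ∨ (j = l ∧ k = n) ∨ (j = n ∧ k = l))) ∨
    (i = n ∧ ((j = k ∧ l = m) ∨ (j = l ∧ k = m) ∨ (j = m ∧ k = l))) := by
  apply match_six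
  intro v hv
  obtain ⟨φ, h1, h2, h3⟩ := H.sgn v
  have key : ∀ t k, φ (letter a b t k) = sgnAt v k • letter a b t k := by
    intro t k; cases t <;> simp [letter, h2, h3]
  have h := h1 (letter a b t1 i) (letter a b t2 j) (letter a b t3 k)
    (letter a b t4 l) (letter a b t5 m) (letter a b t6 n)
  simp only [key, wdg_smul1, wdg_smul2, wdg_smul3, map_zsmul, LinearMap.smul_apply,
    zsmul_eq_mul] at h
  have hv' : (sgnAt v i : K) * sgnAt v j * sgnAt v k * sgnAt v l * sgnAt v m * sgnAt v n = -1 := by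
    exact_mod_cast congrArg (Int.cast : ℤ → K) hv
  apply h0
  have : (2 : K) * B (wdg K (letter a b t1 i) (letter a b t2 j) (letter a b t3 k))
      (wdg K (letter a b t4 l) (letter a b t5 m) (letter a b t6 n)) = 0 := by
    linear_combination -h + B (wdg K (letter a b t1 i) (letter a b t2 j) (letter a b t3 k))
      (wdg K (letter a b t4 l) (letter a b t5 m) (letter a b t6 n)) * hv'
  exact (mul_eq_zero.mp this).resolve_left H.two_ne

end GoodForm

end Wedge

attribute [irreducible] wdg

section Types

variable {K V : Type*} [Field K] [AddCommGroup V] [Module K V]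

namespace GoodForm

variable {g : ℕ} {a b : Fin g → V} {B : (⋀[K]^3 V) →ₗ[K] (⋀[K]^3 V) →ₗ[K] K}

/-! Type `AAA | AAA`. -/
theorem zero_aaa_aaa (H : GoodForm a b B) (i j k l m n : Fin g) :
    B (wdg K (a i) (a j) (a k)) (wdg K (a l) (a m) (a n)) = 0 := by
  by_contra h0
  have hm := H.parity true true true true true true i j k l m n (by simpa [letter] using h0)
  apply h0
  have d := H.alt (wdg K (a i) (a j) (a k))
  have z12 := wdg_z12 (K := K) (V := V)
  have z13 := wdg_z13 (K := K) (V := V)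
  have z23 := wdg_z23 (K := K) (V := V)
  have s12 := wdg_swap12 (K := K) (a i) (a j) (a k)
  have s23 := wdg_swap23 (K := K) (a i) (a j) (a k)
  have s1 := wdg_swap12 (K := K) (a i) (a k) (a j)
  have s2 := wdg_swap23 (K := K) (a j) (a i) (a k)
  have s3 := wdg_swap23 (K := K) (a k) (a i) (a j)
  rcases hm with ⟨rfl, hm⟩ | ⟨rfl, hm⟩ | ⟨rfl, hm⟩ | ⟨rfl, hm⟩ | ⟨rfl, hm⟩ <;>
  rcases hm with ⟨rfl, rfl⟩ | ⟨rfl, rfl⟩ | ⟨rfl, rfl⟩ <;>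
  simp_all

/-! Type `AAA | AAB`. -/
theorem aux_aaa_aab (H : GoodForm a b B) (i j k : Fin g) (hij : i ≠ j) (hik : i ≠ k)
    (hjk : j ≠ k) :
    B (wdg K (a i) (a j) (a k)) (wdg K (a i) (a j) (b k)) = 0 := by
  obtain ⟨φ, h1, h2, h3, h4, h5⟩ := H.elem i k hik
  have h := h1 (a i) (a j) (a k) (a i) (a j) (b i)
  rw [h2, h3, h4 i hik, h4 j hjk] at h
  simpa only [wdg_add3, wdg_sub3, wdg_z13, map_add, map_sub, add_zero, LinearMap.add_apply,
    sub_eq_self] using h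

theorem aux_aaa_abb (H : GoodForm a b B) (i j k : Fin g) (hij : i ≠ j) (hik : i ≠ k)
    (hjk : j ≠ k) :
    B (wdg K (a i) (a j) (a k)) (wdg K (a i) (b j) (b k)) = 0 := by
  obtain ⟨φ, h1, h2, h3, h4, h5⟩ := H.elem i j hij
  have h := h1 (a i) (a j) (a k) (a i) (b i) (b k)
  rw [h2, h3, h4 i hij, h4 k hjk.symm, h5 k hik.symm] at h
  simpa only [wdg_add2, wdg_sub2, wdg_z12, map_add, map_sub, add_zero, LinearMap.add_apply,
    sub_eq_self] using h

theorem aux_aab_aab1 (H : GoodForm a b B) (i j k : Fin g) (hij : i ≠ j) (hik : i ≠ k)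
    (hjk : j ≠ k) :
    B (wdg K (a i) (a j) (b k)) (wdg K (a i) (a k) (b j)) = 0 := by
  obtain ⟨φ, h1, h2, h3, h4, h5⟩ := H.elem i j hij
  have h := h1 (a i) (a j) (b k) (a i) (a k) (b i)
  rw [h2, h3, h4 i hij, h4 k hjk.symm, h5 k hik.symm] at h
  simpa only [wdg_add2, wdg_sub3, wdg_z12, map_add, map_sub, add_zero, LinearMap.add_apply,
    sub_eq_self] using h

theorem aux_aab_aab2 (H : GoodForm a b B) (i j k : Fin g) (hij : i ≠ j) (hik : i ≠ k)
    (hjk : j ≠ k) :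
    B (wdg K (a i) (a j) (b i)) (wdg K (a k) (a j) (b k)) = 0 := by
  obtain ⟨φ, h1, h2, h3, h4, h5⟩ := H.elem j i hij.symm
  have h := h1 (a i) (a j) (b j) (a k) (a j) (b k)
  rw [h2, h3, h4 j hij.symm, h4 k hik.symm, h5 k hjk.symm] at h
  simpa only [wdg_add1, wdg_sub3, wdg_z12, map_add, map_sub, add_zero, LinearMap.add_apply,
    LinearMap.sub_apply, sub_eq_self] using h

theorem aux_aab_abb (H : GoodForm a b B) (i j k : Fin g) (hij : i ≠ j) (hik : i ≠ k)
    (hjk : j ≠ k) :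
    B (wdg K (a i) (a j) (b k)) (wdg K (a i) (b k) (b j)) = 0 := by
  obtain ⟨φ, h1, h2, h3, h4, h5⟩ := H.elem i k hik
  have h := h1 (a i) (a j) (b k) (a i) (b i) (b j)
  rw [h3, h4 i hik, h4 j hjk, h5 k hik.symm, h5 j hij.symm] at h
  simpa only [wdg_add1, wdg_sub2, wdg_z12, map_add, map_sub, add_zero, LinearMap.add_apply,
    LinearMap.sub_apply, sub_eq_self] using h

theorem aux_rel (H : GoodForm a b B) (i j k : Fin g) (hij : i ≠ j) (hik : i ≠ k)
    (hjk : j ≠ k) :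
    B (wdg K (a i) (a j) (b i)) (wdg K (a i) (b i) (b j)) =
      B (wdg K (a i) (a j) (b i)) (wdg K (a k) (b k) (b j)) +
      B (wdg K (a i) (a j) (b k)) (wdg K (a k) (b i) (b j)) := by
  obtain ⟨φ, h1, h2, h3, h4, h5⟩ := H.elem i k hik
  have h := h1 (a i) (a j) (b i) (a k) (b i) (b j)
  rw [h2, h3, h4 i hik, h4 j hjk, h5 j hij.symm] at h
  have e1 := H.aux_aab_abb i j k hij hik hjk
  have p1 : B (wdg K (a i) (a j) (b k)) (wdg K (a i) (b i) (b j)) = 0 := by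
    by_contra h0
    have hm := H.parity true true false true false false i j k i i j
      (by simpa [letter] using h0)
    grind
  have p2 : B (wdg K (a i) (a j) (b k)) (wdg K (a k) (b k) (b j)) = 0 := by
    by_contra h0
    have hm := H.parity true true false true false false i j k k k j
      (by simpa [letter] using h0)
    grind
  have p3 : B (wdg K (a i) (a j) (b i)) (wdg K (a i) (b k) (b j)) = 0 := by
    by_contra h0
    have hm := H.parity true true false true false false i j i i k j
      (by simpa [letter] using h0)
    grind
  simp only [wdg_add1, wdg_sub2, wdg_sub3, map_add, map_sub,
    LinearMap.sub_apply, e1, p1, p2, p3] at h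
  linear_combination h

theorem zero_aaa_aab (H : GoodForm a b B) (i j k l m n : Fin g) :
    B (wdg K (a i) (a j) (a k)) (wdg K (a l) (a m) (b n)) = 0 := by
  by_contra h0
  have hm := H.parity true true true true true false i j k l m n (by simpa [letter] using h0)
  apply h0
  have z12 := wdg_z12 (K := K) (V := V)
  have z13 := wdg_z13 (K := K) (V := V)
  have z23 := wdg_z23 (K := K) (V := V)
  have hij : i ≠ j := by rintro rfl; simp [z12] at h0
  have hik : i ≠ k := by rintro rfl; simp [z13] at h0
  have hjk : j ≠ k := by rintro rfl; simp [z23] at h0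
  have e1 := H.aux_aaa_aab i j k hij hik hjk
  have e2 := H.aux_aaa_aab i k j hik hij hjk.symm
  have e3 := H.aux_aaa_aab j k i hjk hij.symm hik.symm
  rw [wdg_swap23 (a i) (a j) (a k)] at e2
  rw [wdg_swap23 (a j) (a i) (a k), wdg_swap12 (a i) (a j) (a k)] at e3
  simp only [map_neg, LinearMap.neg_apply, neg_neg, neg_eq_zero] at e2 e3
  have s1 := wdg_swap12 (K := K) (a i) (a j) (b k)
  have s2 := wdg_swap12 (K := K) (a i) (a k) (b j)
  have s3 := wdg_swap12 (K := K) (a j) (a k) (b i)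
  rcases hm with ⟨rfl, hm⟩ | ⟨rfl, hm⟩ | ⟨rfl, hm⟩ | ⟨rfl, hm⟩ | ⟨rfl, hm⟩ <;>
  rcases hm with ⟨rfl, rfl⟩ | ⟨rfl, rfl⟩ | ⟨rfl, rfl⟩ <;>
  first
  | exact absurd rfl hij
  | exact absurd rfl hik
  | exact absurd rfl hjk
  | simp [*]

theorem zero_aaa_abb (H : GoodForm a b B) (i j k l m n : Fin g) :
    B (wdg K (a i) (a j) (a k)) (wdg K (a l) (b m) (b n)) = 0 := by
  by_contra h0
  have hm := H.parity true true true true false false i j k l m n (by simpa [letter] using h0)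
  apply h0
  have z12 := wdg_z12 (K := K) (V := V)
  have z13 := wdg_z13 (K := K) (V := V)
  have z23 := wdg_z23 (K := K) (V := V)
  have hij : i ≠ j := by rintro rfl; simp [z12] at h0
  have hik : i ≠ k := by rintro rfl; simp [z13] at h0
  have hjk : j ≠ k := by rintro rfl; simp [z23] at h0
  have e1 := H.aux_aaa_abb i j k hij hik hjk
  have e2 := H.aux_aaa_abb j i k hij.symm hjk hik
  have e3 := H.aux_aaa_abb k i j hik.symm hjk.symm hij
  rw [wdg_swap12 (a i) (a j) (a k)] at e2
  rw [wdg_swap12 (a i) (a k) (a j), wdg_swap23 (a i) (a j) (a k)] at e3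
  simp only [map_neg, LinearMap.neg_apply, neg_neg, neg_eq_zero] at e2 e3
  have s1 := wdg_swap23 (K := K) (a i) (b j) (b k)
  have s2 := wdg_swap23 (K := K) (a j) (b i) (b k)
  have s3 := wdg_swap23 (K := K) (a k) (b i) (b j)
  rcases hm with ⟨rfl, hm⟩ | ⟨rfl, hm⟩ | ⟨rfl, hm⟩ | ⟨rfl, hm⟩ | ⟨rfl, hm⟩ <;>
  rcases hm with ⟨rfl, rfl⟩ | ⟨rfl, rfl⟩ | ⟨rfl, rfl⟩ <;>
  first
  | exact absurd rfl hij
  | exact absurd rfl hik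
  | exact absurd rfl hjk
  | simp [*]

set_option maxHeartbeats 2000000 in
theorem zero_aab_aab (H : GoodForm a b B) (i j k l m n : Fin g) :
    B (wdg K (a i) (a j) (b k)) (wdg K (a l) (a m) (b n)) = 0 := by
  by_contra h0
  have hm := H.parity true true false true true false i j k l m n (by simpa [letter] using h0)
  apply h0
  have z12 := wdg_z12 (K := K) (V := V)
  have hij : i ≠ j := by rintro rfl; simp [z12] at h0
  have hlm : l ≠ m := by rintro rfl; simp [z12] at h0
  have sL : ∀ (x y z : V) u, B (wdg K y x z) u = 0 → B (wdg K x y z) u = 0 := by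
    intro x y z u h
    rw [wdg_swap12, map_neg, LinearMap.neg_apply, h, neg_zero]
  have sR : ∀ (x y z : V) u, B u (wdg K y x z) = 0 → B u (wdg K x y z) = 0 := by
    intro x y z u h
    rw [wdg_swap12, map_neg, h, neg_zero]
  have A1 : ∀ i j k, i ≠ j → B (wdg K (a i) (a j) (b k)) (wdg K (a i) (a k) (b j)) = 0 := by
    intro i j k hij
    by_cases hik : i = k
    · subst hik; simp [z12]
    by_cases hjk : j = k
    · subst hjk; exact H.alt _
    exact H.aux_aab_aab1 i j k hij hik hjk
  have A2 : ∀ i j k, i ≠ j → k ≠ j →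
      B (wdg K (a i) (a j) (b i)) (wdg K (a k) (a j) (b k)) = 0 := by
    intro i j k hij hkj
    by_cases hik : i = k
    · subst hik; exact H.alt _
    exact H.aux_aab_aab2 i j k hij hik hkj.symm
  rcases hm with ⟨rfl, hm⟩ | ⟨rfl, hm⟩ | ⟨rfl, hm⟩ | ⟨rfl, hm⟩ | ⟨rfl, hm⟩ <;>
  rcases hm with ⟨rfl, rfl⟩ | ⟨rfl, rfl⟩ | ⟨rfl, rfl⟩ <;>
  first
  | exact absurd rfl hij
  | exact absurd rfl hlm
  | exact H.alt _
  | exact sR _ _ _ _ (H.alt _)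
  | exact A1 _ _ _ hij
  | exact sL _ _ _ _ (A1 _ _ _ hij.symm)
  | exact sR _ _ _ _ (A1 _ _ _ hij)
  | exact sL _ _ _ _ (sR _ _ _ _ (A1 _ _ _ hij.symm))
  | exact A2 _ _ _ hij hlm
  | exact sL _ _ _ _ (A2 _ _ _ hij.symm hlm)
  | exact sR _ _ _ _ (A2 _ _ _ hij hlm.symm)
  | exact sL _ _ _ _ (sR _ _ _ _ (A2 _ _ _ hij.symm hlm.symm))

theorem zero_aaa_bbb (H : GoodForm a b B) (i₀ j₀ k₀ : Fin g) (hij₀ : i₀ ≠ j₀) (hik₀ : i₀ ≠ k₀)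
    (hjk₀ : j₀ ≠ k₀)
    (hc : B (wdg K (a i₀) (a j₀) (a k₀)) (wdg K (b i₀) (b j₀) (b k₀)) = 0)
    (i j k l m n : Fin g) :
    B (wdg K (a i) (a j) (a k)) (wdg K (b l) (b m) (b n)) = 0 := by
  by_contra h0
  have hm := H.parity true true true false false false i j k l m n (by simpa [letter] using h0)
  apply h0
  have z12 := wdg_z12 (K := K) (V := V)
  have z13 := wdg_z13 (K := K) (V := V)
  have z23 := wdg_z23 (K := K) (V := V)
  have hij : i ≠ j := by rintro rfl; simp [z12] at h0
  have hik : i ≠ k := by rintro rfl; simp [z13] at h0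
  have hjk : j ≠ k := by rintro rfl; simp [z23] at h0
  have key : B (wdg K (a i) (a j) (a k)) (wdg K (b i) (b j) (b k)) = 0 := by
    obtain ⟨σ, rfl, rfl, rfl⟩ := exists_perm_three i₀ j₀ k₀ i j k hij₀ hik₀ hjk₀ hij hik hjk
    obtain ⟨φ, h1, h2, h3⟩ := H.perm σ
    have h := h1 (a i₀) (a j₀) (a k₀) (b i₀) (b j₀) (b k₀)
    rw [hc] at h
    simpa only [h2, h3] using h
  have s12 := wdg_swap12 (K := K) (b i) (b j) (b k)
  have s23 := wdg_swap23 (K := K) (b i) (b j) (b k)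
  have s1 := wdg_swap12 (K := K) (b i) (b k) (b j)
  have s2 := wdg_swap23 (K := K) (b j) (b i) (b k)
  have s3 := wdg_swap23 (K := K) (b k) (b i) (b j)
  rcases hm with ⟨rfl, hm⟩ | ⟨rfl, hm⟩ | ⟨rfl, hm⟩ | ⟨rfl, hm⟩ | ⟨rfl, hm⟩ <;>
  rcases hm with ⟨rfl, rfl⟩ | ⟨rfl, rfl⟩ | ⟨rfl, rfl⟩ <;>
  first
  | exact absurd rfl hij
  | exact absurd rfl hik
  | exact absurd rfl hjk
  | simp [*]

set_option maxHeartbeats 2000000 in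
theorem zero_aab_abb (H : GoodForm a b B) (i₀ j₀ k₀ : Fin g) (hij₀ : i₀ ≠ j₀) (hik₀ : i₀ ≠ k₀)
    (hjk₀ : j₀ ≠ k₀)
    (hβ : B (wdg K (a i₀) (a j₀) (b i₀)) (wdg K (a k₀) (b k₀) (b j₀)) = 0)
    (hγ : B (wdg K (a i₀) (a j₀) (b k₀)) (wdg K (a k₀) (b i₀) (b j₀)) = 0)
    (i j k l m n : Fin g) :
    B (wdg K (a i) (a j) (b k)) (wdg K (a l) (b m) (b n)) = 0 := by
  by_contra h0
  have hm := H.parity true true false true false false i j k l m n (by simpa [letter] using h0)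
  apply h0
  have z12 := wdg_z12 (K := K) (V := V)
  have z23 := wdg_z23 (K := K) (V := V)
  have hij : i ≠ j := by rintro rfl; simp [z12] at h0
  have hmn : m ≠ n := by rintro rfl; simp [z23] at h0
  have sL : ∀ (x y z : V) u, B (wdg K y x z) u = 0 → B (wdg K x y z) u = 0 := by
    intro x y z u h
    rw [wdg_swap12, map_neg, LinearMap.neg_apply, h, neg_zero]
  have sR : ∀ (x y z : V) u, B u (wdg K x z y) = 0 → B u (wdg K x y z) = 0 := by
    intro x y z u h
    rw [wdg_swap23, map_neg, h, neg_zero]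
  have B3 : ∀ i j k, i ≠ j → i ≠ k → j ≠ k →
      B (wdg K (a i) (a j) (b i)) (wdg K (a k) (b k) (b j)) = 0 := by
    intro i j k hij hik hjk
    obtain ⟨σ, rfl, rfl, rfl⟩ := exists_perm_three i₀ j₀ k₀ i j k hij₀ hik₀ hjk₀ hij hik hjk
    obtain ⟨φ, h1, h2, h3⟩ := H.perm σ
    have h := h1 (a i₀) (a j₀) (b i₀) (a k₀) (b k₀) (b j₀)
    rw [hβ] at h
    simpa only [h2, h3] using h
  have C3 : ∀ i j k, i ≠ j → i ≠ k → j ≠ k →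
      B (wdg K (a i) (a j) (b k)) (wdg K (a k) (b i) (b j)) = 0 := by
    intro i j k hij hik hjk
    obtain ⟨σ, rfl, rfl, rfl⟩ := exists_perm_three i₀ j₀ k₀ i j k hij₀ hik₀ hjk₀ hij hik hjk
    obtain ⟨φ, h1, h2, h3⟩ := H.perm σ
    have h := h1 (a i₀) (a j₀) (b k₀) (a k₀) (b i₀) (b j₀)
    rw [hγ] at h
    simpa only [h2, h3] using h
  have A2 : ∀ i j, i ≠ j →
      B (wdg K (a i) (a j) (b i)) (wdg K (a i) (b i) (b j)) = 0 := by
    intro i j hij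
    obtain ⟨k, hik, hjk⟩ : ∃ k, i ≠ k ∧ j ≠ k := by
      by_contra hcon
      push Not at hcon
      have q1 := hcon i₀
      have q2 := hcon j₀
      have q3 := hcon k₀
      grind
    rw [H.aux_rel i j k hij hik hjk, B3 i j k hij hik hjk, C3 i j k hij hik hjk, add_zero]
  -- the pattern with `i` contracted on the left
  have P1 : ∀ i j l, i ≠ j → l ≠ j →
      B (wdg K (a i) (a j) (b i)) (wdg K (a l) (b l) (b j)) = 0 := by
    intro i j l hij hlj
    by_cases hil : i = l
    · subst hil; exact A2 i j hij
    exact B3 i j l hij hil hlj.symm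
  have P2 : ∀ i j k, i ≠ j → B (wdg K (a i) (a j) (b k)) (wdg K (a k) (b i) (b j)) = 0 := by
    intro i j k hij
    by_cases hik : i = k
    · subst hik; exact A2 i j hij
    by_cases hjk : j = k
    · subst hjk; exact sL _ _ _ _ (sR _ _ _ _ (A2 _ _ hij.symm))
    exact C3 i j k hij hik hjk
  have P3 : ∀ i j k, i ≠ j → k ≠ j →
      B (wdg K (a i) (a j) (b k)) (wdg K (a i) (b k) (b j)) = 0 := by
    intro i j k hij hkj
    by_cases hik : i = k
    · subst hik; exact A2 i j hij
    exact H.aux_aab_abb i j k hij hik hkj.symm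
  rcases hm with ⟨rfl, hm⟩ | ⟨rfl, hm⟩ | ⟨rfl, hm⟩ | ⟨rfl, hm⟩ | ⟨rfl, hm⟩ <;>
  rcases hm with ⟨rfl, rfl⟩ | ⟨rfl, rfl⟩ | ⟨rfl, rfl⟩ <;>
  first
  | exact absurd rfl hij
  | exact absurd rfl hmn
  | exact P1 _ _ _ hij hmn
  | exact sL _ _ _ _ (P1 _ _ _ hij.symm hmn)
  | exact sR _ _ _ _ (P1 _ _ _ hij hmn.symm)
  | exact sL _ _ _ _ (sR _ _ _ _ (P1 _ _ _ hij.symm hmn.symm))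
  | exact P2 _ _ _ hij
  | exact sL _ _ _ _ (P2 _ _ _ hij.symm)
  | exact P3 _ _ _ hij hmn
  | exact sL _ _ _ _ (P3 _ _ _ hij.symm hmn)
  | exact sR _ _ _ _ (P3 _ _ _ hij hmn.symm)
  | exact sL _ _ _ _ (sR _ _ _ _ (P3 _ _ _ hij.symm hmn.symm))

/-- A linear map on trivectors vanishes if it vanishes on sorted basis trivectors. -/
theorem ext_sorted {N : Type*} [AddCommGroup N] [Module K N]
    (e : Module.Basis (Fin g ⊕ Fin g) K V) (ha : ∀ i, e (Sum.inl i) = a i)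
    (hb : ∀ i, e (Sum.inr i) = b i) (f : (⋀[K]^3 V) →ₗ[K] N)
    (h1 : ∀ i j k, f (wdg K (a i) (a j) (a k)) = 0)
    (h2 : ∀ i j k, f (wdg K (a i) (a j) (b k)) = 0)
    (h3 : ∀ i j k, f (wdg K (a i) (b j) (b k)) = 0)
    (h4 : ∀ i j k, f (wdg K (b i) (b j) (b k)) = 0) : f = 0 := by
  apply exteriorPower.linearMap_ext
  apply Module.Basis.ext_alternating e
  intro v _
  have hv : (exteriorPower.ιMulti K 3 fun i => e (v i)) =
      wdg K (e (v 0)) (e (v 1)) (e (v 2)) := by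
    rw [wdg]; congr 1; ext i; fin_cases i <;> rfl
  have sL : ∀ (x y z : V), f (wdg K y x z) = 0 → f (wdg K x y z) = 0 := by
    intro x y z h
    rw [wdg_swap12, map_neg, h, neg_zero]
  have sR : ∀ (x y z : V), f (wdg K x z y) = 0 → f (wdg K x y z) = 0 := by
    intro x y z h
    rw [wdg_swap23, map_neg, h, neg_zero]
  simp only [LinearMap.compAlternatingMap_apply, LinearMap.zero_apply]
  rw [hv]
  rcases v 0 with i | i <;> rcases v 1 with j | j <;> rcases v 2 with k | k <;>
    simp only [ha, hb]
  · exact h1 _ _ _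
  · exact h2 _ _ _
  · exact sR _ _ _ (h2 _ _ _)
  · exact h3 _ _ _
  · exact sL _ _ _ (sR _ _ _ (h2 _ _ _))
  · exact sL _ _ _ (h3 _ _ _)
  · exact sR _ _ _ (sL _ _ _ (h3 _ _ _))
  · exact h4 _ _ _

theorem eq_zero (H : GoodForm a b B)
    (e : Module.Basis (Fin g ⊕ Fin g) K V) (ha : ∀ i, e (Sum.inl i) = a i)
    (hb : ∀ i, e (Sum.inr i) = b i)
    (i₀ j₀ k₀ : Fin g) (hij₀ : i₀ ≠ j₀) (hik₀ : i₀ ≠ k₀) (hjk₀ : j₀ ≠ k₀)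
    (hc : B (wdg K (a i₀) (a j₀) (a k₀)) (wdg K (b i₀) (b j₀) (b k₀)) = 0)
    (hβ : B (wdg K (a i₀) (a j₀) (b i₀)) (wdg K (a k₀) (b k₀) (b j₀)) = 0)
    (hγ : B (wdg K (a i₀) (a j₀) (b k₀)) (wdg K (a k₀) (b i₀) (b j₀)) = 0) : B = 0 := by
  have S : ∀ u v, B v u = 0 → B u v = 0 := by
    intro u v h; rw [H.skew, h, neg_zero]
  have rot : ∀ x y z : V, wdg K y z x = wdg K x y z := by
    intro x y z
    rw [wdg_swap23 y x z, wdg_swap12 x y z, neg_neg]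
  have c1 := H.zero_aaa_bbb i₀ j₀ k₀ hij₀ hik₀ hjk₀ hc
  have c2 := H.zero_aab_abb i₀ j₀ k₀ hij₀ hik₀ hjk₀ hβ hγ
  -- dual statements
  have d1 : ∀ i j k l m n, B (wdg K (b i) (b j) (b k)) (wdg K (a l) (b m) (b n)) = 0 := by
    intro i j k l m n
    rw [← rot (a l)]; exact H.symm.zero_aaa_aab i j k m n l
  have d2 : ∀ i j k l m n, B (wdg K (b i) (b j) (b k)) (wdg K (a l) (a m) (b n)) = 0 := by
    intro i j k l m n
    rw [rot (b n)]; exact H.symm.zero_aaa_abb i j k n l m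
  have d3 : ∀ i j k l m n, B (wdg K (a i) (b j) (b k)) (wdg K (a l) (b m) (b n)) = 0 := by
    intro i j k l m n
    rw [← rot (a l), ← rot (a i)]; exact H.symm.zero_aab_aab j k i m n l
  apply ext_sorted e ha hb
  · intro i j k
    exact ext_sorted e ha hb _ (fun _ _ _ => H.zero_aaa_aaa _ _ _ _ _ _)
      (fun _ _ _ => H.zero_aaa_aab _ _ _ _ _ _) (fun _ _ _ => H.zero_aaa_abb _ _ _ _ _ _)
      (fun _ _ _ => c1 _ _ _ _ _ _)
  · intro i j k
    exact ext_sorted e ha hb _ (fun _ _ _ => S _ _ (H.zero_aaa_aab _ _ _ _ _ _))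
      (fun _ _ _ => H.zero_aab_aab _ _ _ _ _ _) (fun _ _ _ => c2 _ _ _ _ _ _)
      (fun _ _ _ => S _ _ (d2 _ _ _ _ _ _))
  · intro i j k
    exact ext_sorted e ha hb _ (fun _ _ _ => S _ _ (H.zero_aaa_abb _ _ _ _ _ _))
      (fun _ _ _ => S _ _ (c2 _ _ _ _ _ _)) (fun _ _ _ => d3 _ _ _ _ _ _)
      (fun _ _ _ => S _ _ (d1 _ _ _ _ _ _))
  · intro i j k
    exact ext_sorted e ha hb _ (fun _ _ _ => S _ _ (c1 _ _ _ _ _ _))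
      (fun _ _ _ => d2 _ _ _ _ _ _) (fun _ _ _ => d1 _ _ _ _ _ _)
      (fun _ _ _ => H.symm.zero_aaa_aaa _ _ _ _ _ _)

end GoodForm
end Types

section Concrete

theorem extPowerMap_wdg {K V : Type*} [Field K] [AddCommGroup V] [Module K V]
    (φ : V →ₗ[K] V) (x y z : V) :
    extPowerMap 3 φ (wdg K x y z) = wdg K (φ x) (φ y) (φ z) := by
  rw [wdg, wdg]
  apply Subtype.ext
  change ExteriorAlgebra.map φ (ExteriorAlgebra.ιMulti K 3 ![x, y, z]) =
    ExteriorAlgebra.ιMulti K 3 ![φ x, φ y, φ z]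
  rw [ExteriorAlgebra.map_apply_ιMulti]
  congr 1
  ext i; fin_cases i <;> rfl

theorem ext_wdg {K V N : Type*} [Field K] [AddCommGroup V] [Module K V]
    [AddCommGroup N] [Module K N] (f f' : (⋀[K]^3 V) →ₗ[K] N)
    (h : ∀ x y z, f (wdg K x y z) = f' (wdg K x y z)) : f = f' := by
  apply exteriorPower.linearMap_ext
  ext v
  have hv : exteriorPower.ιMulti K 3 v = wdg K (v 0) (v 1) (v 2) := by
    rw [wdg]; congr 1; ext i; fin_cases i <;> rfl
  simp only [LinearMap.compAlternatingMap_apply, hv, h]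

theorem inv_of_wdg {K V : Type*} [Field K] [AddCommGroup V] [Module K V]
    (φ : V →ₗ[K] V) (F : (⋀[K]^3 V) →ₗ[K] (⋀[K]^3 V) →ₗ[K] K)
    (h : InvUnder F φ) (u v : ⋀[K]^3 V) :
    F (extPowerMap 3 φ u) (extPowerMap 3 φ v) = F u v := by
  have : F.compl₁₂ (extPowerMap 3 φ) (extPowerMap 3 φ) = F := by
    apply ext_wdg
    intro x y z
    apply ext_wdg
    intro u v w
    simp only [LinearMap.compl₁₂_apply, extPowerMap_wdg]
    exact h _ _ _ _ _ _
  exact LinearMap.congr_fun₂ this u v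

/-- The pairing on trivectors induced by a bilinear form. -/
noncomputable def detForm {K V : Type*} [Field K] [AddCommGroup V] [Module K V]
    (L : V →ₗ[K] V →ₗ[K] K) : (⋀[K]^3 V) →ₗ[K] (⋀[K]^3 V) →ₗ[K] K :=
  (exteriorPower.pairingDual K V 3) ∘ₗ (exteriorPower.map 3 L)

theorem detForm_wdg {K V : Type*} [Field K] [AddCommGroup V] [Module K V]
    (L : V →ₗ[K] V →ₗ[K] K) (x y z u v w : V) :
    detForm L (wdg K x y z) (wdg K u v w) =
      L x u * (L y v * L z w) - L x u * (L z v * L y w) - L y u * (L x v * L z w)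
      + L y u * (L z v * L x w) + L z u * (L x v * L y w) - L z u * (L y v * L x w) := by
  rw [wdg, wdg, detForm, LinearMap.comp_apply, exteriorPower.map_apply_ιMulti]
  erw [exteriorPower.pairingDual_ιMulti_ιMulti]
  rw [Matrix.det_fin_three]
  simp
  ring

/-- The contraction of trivectors with an alternating bilinear form, as an alternating map. -/
noncomputable def contrAlt {K V : Type*} [Field K] [AddCommGroup V] [Module K V]
    (L : V →ₗ[K] V →ₗ[K] K) (hL : ∀ x, L x x = 0) : V [⋀^Fin 3]→ₗ[K] V where
  toFun v := L (v 0) (v 1) • v 2 + L (v 1) (v 2) • v 0 + L (v 2) (v 0) • v 1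
  map_update_add' := by
    intro d m i x y
    have : d = instDecidableEqFin 3 := Subsingleton.elim _ _
    subst this
    fin_cases i <;> simp [Function.update] <;> module
  map_update_smul' := by
    intro d m i c x
    have : d = instDecidableEqFin 3 := Subsingleton.elim _ _
    subst this
    fin_cases i <;> simp [Function.update] <;> module
  map_eq_zero_of_eq' := by
    have hs : ∀ x y, L x y = - L y x := by
      intro x y
      have := hL (x + y)
      simp only [map_add, LinearMap.add_apply, hL] at this
      linear_combination this
    intro v i j hv hij
    fin_cases i <;> fin_cases j <;> simp at hij hv ⊢
    · rw [hv, hL, hs (v 2) (v 1)]; module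
    · rw [hv, hL, hs (v 2) (v 1)]; module
    · rw [hv, hL, hs (v 2) (v 0)]; module
    · rw [hv, hL, hs (v 2) (v 0)]; module
    · rw [hv, hL, hs (v 1) (v 0)]; module
    · rw [hv, hL, hs (v 1) (v 0)]; module

/-- The contraction of trivectors with an alternating bilinear form. -/
noncomputable def contr {K V : Type*} [Field K] [AddCommGroup V] [Module K V]
    (L : V →ₗ[K] V →ₗ[K] K) (hL : ∀ x, L x x = 0) : (⋀[K]^3 V) →ₗ[K] V :=
  exteriorPower.alternatingMapLinearEquiv (contrAlt L hL)

theorem contr_wdg {K V : Type*} [Field K] [AddCommGroup V] [Module K V]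
    (L : V →ₗ[K] V →ₗ[K] K) (hL : ∀ x, L x x = 0) (x y z : V) :
    contr L hL (wdg K x y z) = L x y • z + L y z • x + L z x • y := by
  rw [wdg, contr, exteriorPower.alternatingMapLinearEquiv_apply_ιMulti]
  rfl

variable (p g : ℕ) [Fact p.Prime]

/-- Basis vector `a_i`. -/
def avec (i : Fin g) : Hsp p g := (Pi.single i 1, 0)
/-- Basis vector `b_i`. -/
def bvec (i : Fin g) : Hsp p g := (0, Pi.single i 1)

/-- The bilinear pairing of the `a`-part with the `b`-part. -/
noncomputable def lam : Hsp p g →ₗ[ZMod p] Hsp p g →ₗ[ZMod p] ZMod p :=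
  LinearMap.mk₂ (ZMod p) (fun x y => x.1 ⬝ᵥ y.2)
    (by intros; simp [add_dotProduct]) (by intros; simp)
    (by intros; simp [dotProduct_add]) (by intros; simp)

theorem lam_apply (x y : Hsp p g) : lam p g x y = x.1 ⬝ᵥ y.2 := rfl

theorem lam_inv (G : GL (Fin g) ℤ) (x y : Hsp p g) :
    lam p g (phiGp p g G x) (phiGp p g G y) = lam p g x y := by
  have h : ((↑(G⁻¹) : Matrix (Fin g) (Fin g) ℤ).map (Int.cast : ℤ → ZMod p)) *
      ((G : Matrix (Fin g) (Fin g) ℤ).map (Int.cast : ℤ → ZMod p)) = 1 := by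
    have h1 : (↑(G⁻¹) : Matrix (Fin g) (Fin g) ℤ) * (G : Matrix (Fin g) (Fin g) ℤ) = 1 := by
      rw [← Units.val_mul, inv_mul_cancel, Units.val_one]
    have h2 := congrArg (fun M : Matrix (Fin g) (Fin g) ℤ => M.map (Int.castRingHom (ZMod p))) h1
    simp only [Matrix.map_mul] at h2
    rw [Matrix.map_one _ (by simp) (by simp)] at h2
    exact h2
  simp only [lam_apply, phiGp, LinearMap.prodMap_apply, Matrix.toLin'_apply]
  rw [Matrix.transpose_map, Matrix.mulVec_transpose, dotProduct_comm,
    ← Matrix.dotProduct_mulVec, Matrix.mulVec_mulVec, h, Matrix.one_mulVec, dotProduct_comm]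

@[simp] theorem lam_ab (i j : Fin g) : lam p g (avec p g i) (bvec p g j) = if i = j then 1 else 0 := by
  simp [lam_apply, avec, bvec, Pi.single_apply, eq_comm]
@[simp] theorem lam_aa (i j : Fin g) : lam p g (avec p g i) (avec p g j) = 0 := by
  simp [lam_apply, avec]
@[simp] theorem lam_bb (i j : Fin g) : lam p g (bvec p g i) (bvec p g j) = 0 := by
  simp [lam_apply, bvec]
@[simp] theorem lam_ba (i j : Fin g) : lam p g (bvec p g i) (avec p g j) = 0 := by
  simp [lam_apply, avec, bvec]

/-- The symplectic form. -/
noncomputable def omg : Hsp p g →ₗ[ZMod p] Hsp p g →ₗ[ZMod p] ZMod p :=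
  lam p g - (lam p g).flip

theorem omg_apply (x y : Hsp p g) : omg p g x y = lam p g x y - lam p g y x := rfl

theorem omg_self (x : Hsp p g) : omg p g x x = 0 := by rw [omg_apply, sub_self]

/-- First form before antisymmetrisation. -/
noncomputable def preForm (k₀ k₁ k₂ : ZMod p) :
    (⋀[ZMod p]^3 (Hsp p g)) →ₗ[ZMod p] (⋀[ZMod p]^3 (Hsp p g)) →ₗ[ZMod p] ZMod p :=
  k₀ • detForm (lam p g) + k₁ • detForm (omg p g) +
    k₂ • (lam p g).compl₁₂ (contr (omg p g) (omg_self p g)) (contr (omg p g) (omg_self p g))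

theorem preForm_wdg (k₀ k₁ k₂ : ZMod p) (x y z u v w : Hsp p g) :
    preForm p g k₀ k₁ k₂ (wdg (ZMod p) x y z) (wdg (ZMod p) u v w) =
      k₀ * detForm (lam p g) (wdg (ZMod p) x y z) (wdg (ZMod p) u v w) +
      k₁ * detForm (omg p g) (wdg (ZMod p) x y z) (wdg (ZMod p) u v w) +
      k₂ * lam p g (omg p g x y • z + omg p g y z • x + omg p g z x • y)
        (omg p g u v • w + omg p g v w • u + omg p g w u • v) := by
  rw [← contr_wdg (omg p g) (omg_self p g), ← contr_wdg (omg p g) (omg_self p g)]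
  rfl

theorem preForm_inv (k₀ k₁ k₂ : ZMod p) (G : GL (Fin g) ℤ) :
    InvUnder (preForm p g k₀ k₁ k₂) (phiGp p g G) := by
  intro x y z u v w
  have ho : ∀ x y, omg p g (phiGp p g G x) (phiGp p g G y) = omg p g x y := by
    intro x y; rw [omg_apply, omg_apply, lam_inv, lam_inv]
  rw [preForm_wdg, preForm_wdg]
  simp only [detForm_wdg, ho, lam_inv]
  simp only [← map_smul, ← map_add, lam_inv]

/-- The antisymmetrised form. -/
noncomputable def theForm (k₀ k₁ k₂ : ZMod p) :
    (⋀[ZMod p]^3 (Hsp p g)) →ₗ[ZMod p] (⋀[ZMod p]^3 (Hsp p g)) →ₗ[ZMod p] ZMod p :=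
  preForm p g k₀ k₁ k₂ - (preForm p g k₀ k₁ k₂).flip

theorem theForm_apply (k₀ k₁ k₂ : ZMod p) (u v) :
    theForm p g k₀ k₁ k₂ u v = preForm p g k₀ k₁ k₂ u v - preForm p g k₀ k₁ k₂ v u := rfl

theorem theForm_c (k₀ k₁ k₂ : ZMod p) (i j k : Fin g) (hij : i ≠ j) (hik : i ≠ k)
    (hjk : j ≠ k) :
    theForm p g k₀ k₁ k₂ (wdg (ZMod p) (avec p g i) (avec p g j) (avec p g k))
      (wdg (ZMod p) (bvec p g i) (bvec p g j) (bvec p g k)) = k₀ + 2 * k₁ := by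
  rw [theForm_apply, preForm_wdg, preForm_wdg]
  simp [detForm_wdg, omg_apply, hij, hik, hjk, hij.symm, hik.symm, hjk.symm]
  ring

theorem theForm_b (k₀ k₁ k₂ : ZMod p) (i j k : Fin g) (hij : i ≠ j) (hik : i ≠ k)
    (hjk : j ≠ k) :
    theForm p g k₀ k₁ k₂ (wdg (ZMod p) (avec p g i) (avec p g j) (bvec p g i))
      (wdg (ZMod p) (avec p g k) (bvec p g k) (bvec p g j)) = - k₂ := by
  rw [theForm_apply, preForm_wdg, preForm_wdg]
  simp [detForm_wdg, omg_apply, hij, hik, hjk, hij.symm, hik.symm, hjk.symm]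

theorem theForm_g (k₀ k₁ k₂ : ZMod p) (i j k : Fin g) (hij : i ≠ j) (hik : i ≠ k)
    (hjk : j ≠ k) :
    theForm p g k₀ k₁ k₂ (wdg (ZMod p) (avec p g i) (avec p g j) (bvec p g k))
      (wdg (ZMod p) (avec p g k) (bvec p g i) (bvec p g j)) = - 2 * k₁ := by
  rw [theForm_apply, preForm_wdg, preForm_wdg]
  simp [detForm_wdg, omg_apply, hij, hik, hjk, hij.symm, hik.symm, hjk.symm]
  ring

theorem phi_a (G : GL (Fin g) ℤ) (j : Fin g) :
    phiGp p g G (avec p g j) =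
      (fun r => (((G : Matrix (Fin g) (Fin g) ℤ) r j : ℤ) : ZMod p), 0) := by
  simp only [phiGp, avec, LinearMap.prodMap_apply, map_zero, Matrix.toLin'_apply,
    Matrix.mulVec_single_one]
  rfl

theorem phi_b (G : GL (Fin g) ℤ) (j : Fin g) :
    phiGp p g G (bvec p g j) =
      (0, fun r => (((↑(G⁻¹) : Matrix (Fin g) (Fin g) ℤ) j r : ℤ) : ZMod p)) := by
  simp only [phiGp, bvec, LinearMap.prodMap_apply, map_zero, Matrix.toLin'_apply,
    Matrix.mulVec_single_one]
  rfl

/-- Transvection as an element of the general linear group. -/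
def tvGL (i j : Fin g) (h : i ≠ j) (c : ℤ) : GL (Fin g) ℤ where
  val := Matrix.transvection i j c
  inv := Matrix.transvection i j (-c)
  val_inv := by rw [Matrix.transvection_mul_transvection_same _ _ h]; simp
  inv_val := by rw [Matrix.transvection_mul_transvection_same _ _ h]; simp

theorem phi_tv_a (i j : Fin g) (h : i ≠ j) (c : ℤ) (k : Fin g) :
    phiGp p g (tvGL g i j h c) (avec p g k) =
      avec p g k + if k = j then c • avec p g i else 0 := by
  rw [phi_a]
  ext r
  · by_cases hk : k = j <;> by_cases hr : r = k <;> by_cases hr' : r = i <;>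
      simp_all [tvGL, Matrix.transvection, avec, Matrix.single_apply, Matrix.one_apply,
        Pi.single_apply, eq_comm]
  · by_cases hk : k = j <;> simp [avec, hk]

theorem phi_tv_b (i j : Fin g) (h : i ≠ j) (c : ℤ) (k : Fin g) :
    phiGp p g (tvGL g i j h c) (bvec p g k) =
      bvec p g k - if k = i then c • bvec p g j else 0 := by
  rw [phi_b]
  have : (↑((tvGL g i j h c)⁻¹) : Matrix (Fin g) (Fin g) ℤ) = Matrix.transvection i j (-c) := rfl
  rw [this]
  ext r
  · by_cases hk : k = i <;> simp [bvec, hk]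
  · by_cases hk : k = i <;> by_cases hr : r = k <;> by_cases hr' : r = j <;>
      simp_all [Matrix.transvection, bvec, Matrix.single_apply, Matrix.one_apply,
        Pi.single_apply, eq_comm, sub_eq_add_neg]

/-- Reflection as an element of the general linear group. -/
def sgnGL (v : Fin g) : GL (Fin g) ℤ where
  val := Matrix.diagonal (sgnAt v)
  inv := Matrix.diagonal (sgnAt v)
  val_inv := by simp [Matrix.diagonal_mul_diagonal, sgnAt_sq]
  inv_val := by simp [Matrix.diagonal_mul_diagonal, sgnAt_sq]

/-- Permutation matrix as an element of the general linear group. -/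
def permGL (σ : Equiv.Perm (Fin g)) : GL (Fin g) ℤ where
  val := Matrix.of fun r c => if r = σ c then 1 else 0
  inv := Matrix.of fun r c => if c = σ r then 1 else 0
  val_inv := by
    ext r c
    simp only [Matrix.mul_apply, Matrix.of_apply, Matrix.one_apply]
    rw [Finset.sum_eq_single (σ.symm r)]
    · simp [eq_comm]
    · intro x _ hx
      have : r ≠ σ x := by rintro rfl; simp at hx
      simp [this]
    · simp
  inv_val := by
    ext r c
    simp [Matrix.mul_apply, Matrix.one_apply, eq_comm]

theorem goodForm_of_inv (hodd : Odd p)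
    (B : (⋀[ZMod p]^3 (Hsp p g)) →ₗ[ZMod p] (⋀[ZMod p]^3 (Hsp p g)) →ₗ[ZMod p] ZMod p)
    (halt : ∀ u, B u u = 0)
    (hinv : ∀ (G : GL (Fin g) ℤ) (u v : ⋀[ZMod p]^3 (Hsp p g)),
        B (extPowerMap 3 (phiGp p g G) u) (extPowerMap 3 (phiGp p g G) v) = B u v) :
    GoodForm (avec p g) (bvec p g) B := by
  have hI : ∀ G, InvUnder B (phiGp p g G) := by
    intro G x y z u v w
    rw [← extPowerMap_wdg, ← extPowerMap_wdg, hinv]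
  refine ⟨?_, halt, ?_, ?_, ?_, ?_⟩
  · intro h
    have h2 : ((2 : ℕ) : ZMod p) = 0 := by exact_mod_cast h
    rw [ZMod.natCast_eq_zero_iff] at h2
    have := (Nat.prime_dvd_prime_iff_eq (Fact.out : p.Prime) Nat.prime_two).mp h2
    subst this
    exact absurd hodd (by decide)
  · intro i j h
    refine ⟨_, hI (tvGL g i j h 1), ?_, ?_, ?_, ?_⟩
    · simp [phi_tv_a]
    · simp [phi_tv_b]
    · intro k hk; simp [phi_tv_a, hk]
    · intro k hk; simp [phi_tv_b, hk]
  · intro i j h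
    refine ⟨_, hI (tvGL g j i h.symm (-1)), ?_, ?_, ?_, ?_⟩
    · simp [phi_tv_b]
    · simp [phi_tv_a, sub_eq_add_neg]
    · intro k hk; simp [phi_tv_b, hk]
    · intro k hk; simp [phi_tv_a, hk]
  · intro v
    refine ⟨_, hI (sgnGL g v), ?_, ?_⟩
    · intro k
      rw [phi_a]
      ext r
      · by_cases hr : r = k
        · subst hr; simp [sgnGL, avec]
        · simp [sgnGL, avec, hr]
      · simp [avec]
    · intro k
      rw [phi_b]
      have : (↑((sgnGL g v)⁻¹) : Matrix (Fin g) (Fin g) ℤ) = Matrix.diagonal (sgnAt v) := rfl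
      rw [this]
      ext r
      · simp [bvec]
      · by_cases hr : r = k
        · subst hr; simp [bvec]
        · simp [bvec, hr, Ne.symm hr]
  · intro σ
    refine ⟨_, hI (permGL g σ), ?_, ?_⟩
    · intro k
      rw [phi_a]
      ext r
      · simp [permGL, avec, Pi.single_apply]
      · simp [avec]
    · intro k
      rw [phi_b]
      have : (↑((permGL g σ)⁻¹) : Matrix (Fin g) (Fin g) ℤ) =
        Matrix.of fun r c => if c = σ r then 1 else 0 := rfl
      rw [this]
      ext r
      · simp [bvec]
      · simp [bvec, Pi.single_apply]

end Concrete

theorem card_gl_invariant_alternating_forms (p g : ℕ) (hp : p.Prime) (hodd : Odd p)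
    (hg : 3 ≤ g) :
    Nat.card {B : (⋀[ZMod p]^3 (Hsp p g)) →ₗ[ZMod p]
        (⋀[ZMod p]^3 (Hsp p g)) →ₗ[ZMod p] ZMod p //
      (∀ u, B u u = 0) ∧
      ∀ (G : GL (Fin g) ℤ) (u v : ⋀[ZMod p]^3 (Hsp p g)),
        B (extPowerMap 3 (phiGp p g G) u) (extPowerMap 3 (phiGp p g G) v) = B u v} =
    p ^ 3 := by
  have : Fact p.Prime := ⟨hp⟩
  set i : Fin g := ⟨0, by omega⟩ with hi
  set j : Fin g := ⟨1, by omega⟩ with hj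
  set k : Fin g := ⟨2, by omega⟩ with hk
  have hij : i ≠ j := by simp [hi, hj]
  have hik : i ≠ k := by simp [hi, hk]
  have hjk : j ≠ k := by simp [hj, hk]
  clear_value i j k
  let a := avec p g
  let b := bvec p g
  let ev : {B : (⋀[ZMod p]^3 (Hsp p g)) →ₗ[ZMod p]
        (⋀[ZMod p]^3 (Hsp p g)) →ₗ[ZMod p] ZMod p //
      (∀ u, B u u = 0) ∧
      ∀ (G : GL (Fin g) ℤ) (u v : ⋀[ZMod p]^3 (Hsp p g)),
        B (extPowerMap 3 (phiGp p g G) u) (extPowerMap 3 (phiGp p g G) v) = B u v} →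
      ZMod p × ZMod p × ZMod p := fun B =>
    (B.1 (wdg (ZMod p) (a i) (a j) (a k)) (wdg (ZMod p) (b i) (b j) (b k)),
     B.1 (wdg (ZMod p) (a i) (a j) (b i)) (wdg (ZMod p) (a k) (b k) (b j)),
     B.1 (wdg (ZMod p) (a i) (a j) (b k)) (wdg (ZMod p) (a k) (b i) (b j)))
  have hbij : Function.Bijective ev := by
    constructor
    · rintro ⟨B, hB1, hB2⟩ ⟨B', hB1', hB2'⟩ h
      simp only [ev, Prod.mk.injEq] at h
      obtain ⟨e1, e2, e3⟩ := h
      have H := goodForm_of_inv p g hodd (B - B')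
        (by intro u; simp [hB1, hB1']) (by intro G u v; simp [hB2, hB2'])
      have := H.eq_zero ((Pi.basisFun (ZMod p) (Fin g)).prod (Pi.basisFun (ZMod p) (Fin g)))
        (by intro i; ext <;> simp [avec]) (by intro i; ext <;> simp [bvec])
        i j k hij hik hjk
        (by rw [LinearMap.sub_apply, LinearMap.sub_apply]; exact sub_eq_zero.mpr e1)
        (by rw [LinearMap.sub_apply, LinearMap.sub_apply]; exact sub_eq_zero.mpr e2)
        (by rw [LinearMap.sub_apply, LinearMap.sub_apply]; exact sub_eq_zero.mpr e3)
      exact Subtype.ext (sub_eq_zero.mp this)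
    · rintro ⟨c, β, γ⟩
      refine ⟨⟨theForm p g (c + γ) (-γ / 2) (-β), ?_, ?_⟩, ?_⟩
      · intro u; rw [theForm_apply, sub_self]
      · intro G u v
        rw [theForm_apply, theForm_apply, inv_of_wdg _ _ (preForm_inv p g _ _ _ G),
          inv_of_wdg _ _ (preForm_inv p g _ _ _ G)]
      · have two_ne : (2 : ZMod p) ≠ 0 :=
          (goodForm_of_inv p g hodd 0 (by simp) (by simp)).two_ne
        simp only [ev, a, b, Prod.mk.injEq]
        rw [theForm_c p g _ _ _ i j k hij hik hjk, theForm_b p g _ _ _ i j k hij hik hjk,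
          theForm_g p g _ _ _ i j k hij hik hjk]
        refine ⟨?_, ?_, ?_⟩
        · field_simp; ring
        · ring
        · field_simp
  rw [Nat.card_congr (Equiv.ofBijective ev hbij)]
  simp only [Nat.card_prod, Nat.card_zmod]
  ring
end

section
/- Let p be an odd prime and g ≥ 4. Let H_p = (ℤ/pℤ)^{2g}, and let Sp_{2g}(ℤ/pℤ) = {M ∈ M_{2g}(ℤ/pℤ) : M·Ω·ᵗM = Ω}, where Ω is the block matrix (0, I_g; −I_g, 0), act on H_p by matrix multiplication. Then the set of ℤ/pℤ-bilinear maps B : ⋀³H_p × ⋀³H_p → ℤ/pℤ that are alternating (B(u,u) = 0 for all u) and satisfy B(⋀³M(u), ⋀³M(v)) = B(u,v) for all M ∈ Sp_{2g}(ℤ/pℤ) and all u, v ∈ ⋀³H_p is a ℤ/pℤ-vector space of dimension 2; equivalently, it has exactly p² elements. -/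
open Matrix

set_option linter.all false
namespace SpInv
section
variable {K : Type*} [Field K] {g : ℕ}

abbrev VV (K : Type*) (g : ℕ) := (Fin g ⊕ Fin g) → K

/-- The standard symplectic form. -/
noncomputable def om (K : Type*) [Field K] (g : ℕ) : VV K g →ₗ[K] VV K g →ₗ[K] K :=
  LinearMap.mk₂ K (fun x y => ∑ m, (x (Sum.inl m) * y (Sum.inr m) - x (Sum.inr m) * y (Sum.inl m)))
    (by intro x x' y; rw [← Finset.sum_add_distrib]; refine Finset.sum_congr rfl fun m _ => ?_
        simp only [Pi.add_apply]; ring)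
    (by intro c x y; rw [Finset.smul_sum]; refine Finset.sum_congr rfl fun m _ => ?_
        simp only [Pi.smul_apply, smul_eq_mul]; ring)
    (by intro x y y'; rw [← Finset.sum_add_distrib]; refine Finset.sum_congr rfl fun m _ => ?_
        simp only [Pi.add_apply]; ring)
    (by intro c x y; rw [Finset.smul_sum]; refine Finset.sum_congr rfl fun m _ => ?_
        simp only [Pi.smul_apply, smul_eq_mul]; ring)

theorem om_apply (x y : VV K g) : om K g x y =
    ∑ m, (x (Sum.inl m) * y (Sum.inr m) - x (Sum.inr m) * y (Sum.inl m)) := rfl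

theorem om_swap (x y : VV K g) : om K g x y = - om K g y x := by
  rw [om_apply, om_apply, ← Finset.sum_neg_distrib]
  refine Finset.sum_congr rfl fun m _ => ?_
  ring

theorem om_self (x : VV K g) : om K g x x = 0 := by
  rw [om_apply]
  refine Finset.sum_eq_zero fun m _ => ?_
  ring

theorem om_eq_dot (x y : VV K g) : om K g x y = x ⬝ᵥ (OmegaMat g K *ᵥ y) := by
  simp [om_apply, OmegaMat, dotProduct, Matrix.mulVec, Matrix.fromBlocks, Matrix.one_apply,
    Finset.sum_add_distrib, sub_eq_add_neg]

theorem omega_iff (M : Matrix (Fin g ⊕ Fin g) (Fin g ⊕ Fin g) K) :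
    M * OmegaMat g K * Mᵀ = OmegaMat g K ↔
      ∀ x y, om K g (M *ᵥ x) (M *ᵥ y) = om K g x y := by
  have hJ : OmegaMat g K = - Matrix.J (Fin g) K := by
    simp [OmegaMat, Matrix.J, Matrix.fromBlocks_neg]
  have h1 : M * OmegaMat g K * Mᵀ = OmegaMat g K ↔ Mᵀ * OmegaMat g K * M = OmegaMat g K := by
    rw [hJ]
    have h := (SymplecticGroup.mem_iff (A := M)).symm.trans SymplecticGroup.mem_iff'
    simpa using h
  have h2 : ∀ x y, om K g (M *ᵥ x) (M *ᵥ y) = x ⬝ᵥ ((Mᵀ * OmegaMat g K * M) *ᵥ y) := by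
    intro x y
    rw [om_eq_dot, ← Matrix.mulVec_mulVec, ← Matrix.mulVec_mulVec, Matrix.dotProduct_mulVec x Mᵀ,
      Matrix.vecMul_transpose]
  rw [h1]
  constructor
  · intro h x y
    rw [h2, h, om_eq_dot]
  · intro h
    ext i j
    have := h (Pi.single i 1) (Pi.single j 1)
    rw [h2, om_eq_dot] at this
    simpa using this

/-- standard basis vectors -/
noncomputable def E (K : Type*) [Field K] {g : ℕ} (s : Fin g ⊕ Fin g) : VV K g := Pi.single s 1

noncomputable abbrev va (K : Type*) [Field K] {g : ℕ} (i : Fin g) : VV K g := E K (Sum.inl i)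
noncomputable abbrev vb (K : Type*) [Field K] {g : ℕ} (i : Fin g) : VV K g := E K (Sum.inr i)

@[simp] theorem om_aa (i j : Fin g) : om K g (va K i) (va K j) = 0 := by
  simp [om_apply, E]
@[simp] theorem om_bb (i j : Fin g) : om K g (vb K i) (vb K j) = 0 := by
  simp [om_apply, E]
@[simp] theorem om_ab (i j : Fin g) : om K g (va K i) (vb K j) = if i = j then 1 else 0 := by
  simp [om_apply, E, Pi.single_apply, Finset.sum_ite_eq, eq_comm]
@[simp] theorem om_ba (i j : Fin g) : om K g (vb K i) (va K j) = if i = j then -1 else 0 := by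
  rw [om_swap, om_ab]; simp only [eq_comm (a := j)]; split_ifs <;> simp

/-- index of basis label -/
def idx (s : Fin g ⊕ Fin g) : Fin g := Sum.elim id id s

/-- `f` models `(x,y) ↦ B(x₁∧x₂∧x₃, y₁∧y₂∧y₃)` for an invariant `B`. -/
structure Sys (f : VV K g → VV K g → VV K g → VV K g → VV K g → VV K g → K) : Prop where
  add1 : ∀ x x' x2 x3 y1 y2 y3, f (x + x') x2 x3 y1 y2 y3 = f x x2 x3 y1 y2 y3 + f x' x2 x3 y1 y2 y3
  neg1 : ∀ x x2 x3 y1 y2 y3, f (-x) x2 x3 y1 y2 y3 = - f x x2 x3 y1 y2 y3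
  swp1 : ∀ x1 x2 x3 y1 y2 y3, f x1 x2 x3 y1 y2 y3 = - f x2 x1 x3 y1 y2 y3
  swp2 : ∀ x1 x2 x3 y1 y2 y3, f x1 x2 x3 y1 y2 y3 = - f x1 x3 x2 y1 y2 y3
  lr : ∀ x1 x2 x3 y1 y2 y3, f x1 x2 x3 y1 y2 y3 = - f y1 y2 y3 x1 x2 x3
  inv : ∀ φ : VV K g →ₗ[K] VV K g, (∀ x y, om K g (φ x) (φ y) = om K g x y) →
    ∀ x1 x2 x3 y1 y2 y3, f (φ x1) (φ x2) (φ x3) (φ y1) (φ y2) (φ y3) = f x1 x2 x3 y1 y2 y3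

namespace Sys
variable {f : VV K g → VV K g → VV K g → VV K g → VV K g → VV K g → K}

theorem swp3 (S : Sys f) (x1 x2 x3 y1 y2 y3) : f x1 x2 x3 y1 y2 y3 = - f x1 x2 x3 y2 y1 y3 := by
  rw [S.lr, S.swp1, S.lr x1]
theorem swp4 (S : Sys f) (x1 x2 x3 y1 y2 y3) : f x1 x2 x3 y1 y2 y3 = - f x1 x2 x3 y1 y3 y2 := by
  rw [S.lr, S.swp2, S.lr x1]
theorem add2 (S : Sys f) (x1 x x' x3 y1 y2 y3) :
    f x1 (x + x') x3 y1 y2 y3 = f x1 x x3 y1 y2 y3 + f x1 x' x3 y1 y2 y3 := by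
  rw [S.swp1, S.add1, S.swp1 x1, S.swp1 x1]; ring
theorem neg2 (S : Sys f) (x1 x x3 y1 y2 y3) :
    f x1 (-x) x3 y1 y2 y3 = - f x1 x x3 y1 y2 y3 := by
  rw [S.swp1, S.neg1, S.swp1 x1]
theorem add3 (S : Sys f) (x1 x2 x x' y1 y2 y3) :
    f x1 x2 (x + x') y1 y2 y3 = f x1 x2 x y1 y2 y3 + f x1 x2 x' y1 y2 y3 := by
  rw [S.swp2, S.add2, S.swp2 x1 x2, S.swp2 x1 x2]; ring
theorem neg3 (S : Sys f) (x1 x2 x y1 y2 y3) :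
    f x1 x2 (-x) y1 y2 y3 = - f x1 x2 x y1 y2 y3 := by
  rw [S.swp2, S.neg2, S.swp2 x1 x2]
theorem add4 (S : Sys f) (x1 x2 x3 y y' y2 y3) :
    f x1 x2 x3 (y + y') y2 y3 = f x1 x2 x3 y y2 y3 + f x1 x2 x3 y' y2 y3 := by
  rw [S.lr, S.add1, S.lr x1, S.lr x1]; ring
theorem neg4 (S : Sys f) (x1 x2 x3 y y2 y3) :
    f x1 x2 x3 (-y) y2 y3 = - f x1 x2 x3 y y2 y3 := by
  rw [S.lr, S.neg1, S.lr x1]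
theorem add5 (S : Sys f) (x1 x2 x3 y1 y y' y3) :
    f x1 x2 x3 y1 (y + y') y3 = f x1 x2 x3 y1 y y3 + f x1 x2 x3 y1 y' y3 := by
  rw [S.lr, S.add2, S.lr x1, S.lr x1]; ring
theorem neg5 (S : Sys f) (x1 x2 x3 y1 y y3) :
    f x1 x2 x3 y1 (-y) y3 = - f x1 x2 x3 y1 y y3 := by
  rw [S.lr, S.neg2, S.lr x1]
theorem add6 (S : Sys f) (x1 x2 x3 y1 y2 y y') :
    f x1 x2 x3 y1 y2 (y + y') = f x1 x2 x3 y1 y2 y + f x1 x2 x3 y1 y2 y' := by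
  rw [S.lr, S.add3, S.lr x1, S.lr x1]; ring
theorem neg6 (S : Sys f) (x1 x2 x3 y1 y2 y) :
    f x1 x2 x3 y1 y2 (-y) = - f x1 x2 x3 y1 y2 y := by
  rw [S.lr, S.neg3, S.lr x1]

theorem rot (S : Sys f) (x1 x2 x3 y1 y2 y3) : f x1 x2 x3 y1 y2 y3 = f x2 x3 x1 y2 y3 y1 := by
  rw [S.swp1, S.swp2, S.swp3, S.swp4]; ring

/-- the transvection along `v` -/
noncomputable def trans (v : VV K g) : VV K g →ₗ[K] VV K g :=
  LinearMap.id + (om K g v).smulRight v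

theorem trans_apply (v x : VV K g) : trans v x = x + om K g v x • v := rfl

theorem trans_pres (v x y : VV K g) : om K g (trans v x) (trans v y) = om K g x y := by
  simp only [trans_apply, map_add, map_smul, LinearMap.add_apply, LinearMap.smul_apply, om_self,
    smul_eq_mul]
  rw [om_swap x v]; ring

/-- the two-vector shear -/
noncomputable def shear (u w : VV K g) : VV K g →ₗ[K] VV K g :=
  LinearMap.id - (om K g u).smulRight w - (om K g w).smulRight u

theorem shear_apply (u w x : VV K g) : shear u w x = x - om K g u x • w - om K g w x • u := rfl

theorem shear_pres (u w : VV K g) (h : om K g u w = 0) (x y : VV K g) :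
    om K g (shear u w x) (shear u w y) = om K g x y := by
  have h' : om K g w u = 0 := by rw [om_swap, h, neg_zero]
  simp only [shear_apply, map_sub, map_smul, LinearMap.sub_apply, LinearMap.smul_apply, om_self,
    smul_eq_mul, h, h']
  rw [om_swap x u, om_swap x w]; ring

/-- the map `-1` on the `i`-th plane -/
noncomputable def sgn (i : Fin g) : VV K g →ₗ[K] VV K g :=
  LinearMap.id + (2 : K) • (om K g (vb K i)).smulRight (va K i)
    - (2 : K) • (om K g (va K i)).smulRight (vb K i)

theorem sgn_apply (i : Fin g) (x : VV K g) : sgn i x =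
  x + (2 : K) • (om K g (vb K i) x • va K i) - (2 : K) • (om K g (va K i) x • vb K i) := rfl

theorem sgn_pres (i : Fin g) (x y : VV K g) :
    om K g (sgn i x) (sgn i y) = om K g x y := by
  simp only [sgn_apply, map_sub, map_add, map_smul, LinearMap.sub_apply, LinearMap.add_apply,
    LinearMap.smul_apply, om_aa, om_bb, om_ab, om_ba, smul_eq_mul]
  rw [om_swap x (va K i), om_swap x (vb K i)]; simp; ring

theorem sgn_E (i : Fin g) (s : Fin g ⊕ Fin g) :
    sgn i (E K s) = if idx s = i then - E K s else E K s := by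
  rcases s with s | s <;> simp only [sgn_apply, om_aa, om_bb, om_ab, om_ba, idx, Sum.elim_inl,
    Sum.elim_inr, id] <;> by_cases h : s = i
  · subst h; simp; module
  · simp [h, Ne.symm h]
  · subst h; simp; module
  · simp [h, Ne.symm h]

theorem om_E_ne (i : Fin g) (s : Fin g ⊕ Fin g) (h : idx s ≠ i) :
    om K g (va K i) (E K s) = 0 ∧ om K g (vb K i) (E K s) = 0 := by
  rcases s with s | s <;> simp [idx] at h <;> simp [Ne.symm h]

theorem eq_zero_of_neg (h2 : (2 : K) ≠ 0) {x : K} (h : -x = x) : x = 0 := by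
  have : (2 : K) * x = 0 := by linear_combination -h
  exact (mul_eq_zero.1 this).resolve_left h2

/-- sign -/
def ep (i : Fin g) (s : Fin g ⊕ Fin g) : ℤ := if idx s = i then -1 else 1

theorem parity (S : Sys f) (h2 : (2 : K) ≠ 0) (i : Fin g) (s1 s2 s3 t1 t2 t3 : Fin g ⊕ Fin g)
    (h : ep i s1 * ep i s2 * ep i s3 * (ep i t1 * ep i t2 * ep i t3) = -1) :
    f (E K s1) (E K s2) (E K s3) (E K t1) (E K t2) (E K t3) = 0 := by
  have := S.inv (sgn i) (sgn_pres i) (E K s1) (E K s2) (E K s3) (E K t1) (E K t2) (E K t3)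
  refine eq_zero_of_neg h2 (Eq.trans ?_ this)
  simp only [sgn_E]
  unfold ep at h
  split_ifs at h ⊢ <;> first | (exfalso; revert h; norm_num; done) |
    simp only [S.neg1, S.neg2, S.neg3, S.neg4, S.neg5, S.neg6, neg_neg]

theorem split (S : Sys f) (i : Fin g) (p q r s : Fin g ⊕ Fin g)
    (hp : idx p ≠ i) (hq : idx q ≠ i) (hr : idx r ≠ i) (hs : idx s ≠ i) :
    f (va K i) (E K p) (E K q) (va K i) (E K r) (E K s) = 0 ∧
    f (vb K i) (E K p) (E K q) (vb K i) (E K r) (E K s) = 0 ∧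
    f (vb K i) (E K p) (E K q) (va K i) (E K r) (E K s) =
      - f (va K i) (E K p) (E K q) (vb K i) (E K r) (E K s) := by
  have A := fun x y => S.inv (trans (va K i)) (trans_pres _) x (E K p) (E K q) y (E K r) (E K s)
  have B := fun x y => S.inv (trans (vb K i)) (trans_pres _) x (E K p) (E K q) y (E K r) (E K s)
  simp only [trans_apply, om_E_ne _ _ hp, om_E_ne _ _ hq, om_E_ne _ _ hr, om_E_ne _ _ hs,
    zero_smul, add_zero] at A B
  have A1 := A (vb K i) (va K i)
  have A2 := A (vb K i) (vb K i)
  have B1 := B (va K i) (vb K i)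
  simp [S.add1, S.add4, S.neg1, S.neg4] at A1 A2 B1
  refine ⟨A1, B1, ?_⟩
  rw [A1] at A2
  linear_combination A2

theorem red (S : Sys f) (i : Fin g) (p q r s u v : Fin g ⊕ Fin g)
    (hp : idx p ≠ i) (hq : idx q ≠ i) (hr : idx r ≠ i) (hs : idx s ≠ i)
    (hu : idx u = i) (hv : idx v = i)
    (h : f (va K i) (E K p) (E K q) (vb K i) (E K r) (E K s) = 0) :
    f (E K u) (E K p) (E K q) (E K v) (E K r) (E K s) = 0 := by
  obtain ⟨h1, h2, h3⟩ := S.split i p q r s hp hq hr hs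
  rw [h, neg_zero] at h3
  rcases u with u | u <;> rcases v with v | v <;> simp [idx] at hu hv <;> subst hu <;> subst hv <;>
    assumption

theorem L1 (S : Sys f)
    (hc : ∀ i j k : Fin g, i ≠ j → i ≠ k → j ≠ k →
      f (va K i) (va K j) (va K k) (vb K i) (vb K j) (vb K k) = 0)
    (s1 s2 s3 t1 t2 t3 : Fin g ⊕ Fin g) (h12 : idx s1 ≠ idx s2) (h13 : idx s1 ≠ idx s3)
    (h23 : idx s2 ≠ idx s3) (e1 : idx t1 = idx s1) (e2 : idx t2 = idx s2) (e3 : idx t3 = idx s3) :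
    f (E K s1) (E K s2) (E K s3) (E K t1) (E K t2) (E K t3) = 0 := by
  have ha : ∀ i : Fin g, idx (Sum.inl i : Fin g ⊕ Fin g) = i := fun _ => rfl
  have hb : ∀ i : Fin g, idx (Sum.inr i : Fin g ⊕ Fin g) = i := fun _ => rfl
  have h21 := h12.symm
  have h31 := h13.symm
  have h32 := h23.symm
  apply S.red (idx s1) <;> try (first | assumption | rfl | (simp only [ha, hb, e1, e2, e3]; assumption))
  rw [S.rot]
  apply S.red (idx s2) <;> try (first | assumption | rfl | (simp only [ha, hb, e1, e2, e3]; assumption))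
  rw [S.rot]
  apply S.red (idx s3) <;> try (first | assumption | rfl | (simp only [ha, hb, e1, e2, e3]; assumption))
  rw [S.rot]
  exact hc _ _ _ h12 h13 h23

theorem rel (S : Sys f) (h2 : (2 : K) ≠ 0)
    (hc : ∀ i j k : Fin g, i ≠ j → i ≠ k → j ≠ k →
      f (va K i) (va K j) (va K k) (vb K i) (vb K j) (vb K k) = 0)
    (hd : ∀ i j k : Fin g, i ≠ j → i ≠ k → j ≠ k →
      f (va K i) (va K j) (vb K j) (vb K i) (va K k) (vb K k) = 0)
    (i j k : Fin g) (hij : i ≠ j) (hik : i ≠ k) (hjk : j ≠ k) :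
      f (va K i) (va K j) (vb K j) (vb K i) (va K j) (vb K j) = 0 := by
  have P := S.parity h2 j
  have Q := S.parity h2 k
  have I := S.inv (shear (vb K j) (va K k)) (shear_pres _ _ (by simp [hjk]))
    (va K i) (va K j) (vb K j) (vb K i) (va K j) (vb K k)
  simp [shear_apply, hij, hik, hjk, hij.symm, hik.symm, hjk.symm] at I
  have c1 := S.L1 hc (Sum.inl i) (Sum.inl k) (Sum.inr j) (Sum.inr i) (Sum.inr k) (Sum.inl j)
    hik hij hjk.symm rfl rfl rfl
  rw [S.swp4] at c1
  have c2 := hd i j k hij hik hjk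
  simp only [sub_eq_add_neg, S.add1, S.add2, S.add3, S.add4, S.add5, S.add6, S.neg1, S.neg2, S.neg3,
    S.neg4, S.neg5, S.neg6] at I
  have c3 := S.L1 hc (Sum.inl i) (Sum.inl k) (Sum.inr j) (Sum.inr i) (Sum.inl k) (Sum.inr j)
    hik hij hjk.symm rfl rfl rfl
  have z1 := P (Sum.inl i) (Sum.inl j) (Sum.inr j) (Sum.inr i) (Sum.inl j) (Sum.inr k)
    (by simp [ep, idx, hij, hjk.symm])
  have z2 := P (Sum.inl i) (Sum.inl k) (Sum.inr j) (Sum.inr i) (Sum.inl k) (Sum.inr k)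
    (by simp [ep, idx, hij, hjk.symm])
  have z3 := P (Sum.inl i) (Sum.inl j) (Sum.inr j) (Sum.inr i) (Sum.inl k) (Sum.inr j)
    (by simp [ep, idx, hij, hjk.symm])
  have z4 := Q (Sum.inl i) (Sum.inl k) (Sum.inr j) (Sum.inr i) (Sum.inl j) (Sum.inr j)
    (by simp [ep, idx, hik, hjk])
  simp only [z1, z2, z3, z4, c2, c3] at I
  linear_combination -I - c1

/-- permutation -/
noncomputable def prm (σ : Equiv.Perm (Fin g)) : VV K g →ₗ[K] VV K g :=
  LinearMap.funLeft K K (Sum.map σ.symm σ.symm)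

theorem prm_pres (σ : Equiv.Perm (Fin g)) (x y : VV K g) :
    om K g (prm σ x) (prm σ y) = om K g x y := by
  simp only [om_apply, prm, LinearMap.funLeft_apply, Sum.map_inl, Sum.map_inr]
  exact Equiv.sum_comp σ.symm
    (fun m => x (Sum.inl m) * y (Sum.inr m) - x (Sum.inr m) * y (Sum.inl m))

theorem prm_a (σ : Equiv.Perm (Fin g)) (i : Fin g) : prm σ (va K i) = va K (σ i) := by
  ext s
  rcases s with s | s <;> simp [prm, LinearMap.funLeft_apply, E, Pi.single_apply, Equiv.symm_apply_eq]

theorem prm_b (σ : Equiv.Perm (Fin g)) (i : Fin g) : prm σ (vb K i) = vb K (σ i) := by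
  ext s
  rcases s with s | s <;> simp [prm, LinearMap.funLeft_apply, E, Pi.single_apply, Equiv.symm_apply_eq]

theorem exists_perm {i j k i' j' k' : Fin g} (hij : i ≠ j) (hik : i ≠ k) (hjk : j ≠ k)
    (hij' : i' ≠ j') (hik' : i' ≠ k') (hjk' : j' ≠ k') :
    ∃ σ : Equiv.Perm (Fin g), σ i = i' ∧ σ j = j' ∧ σ k = k' := by
  let σ1 := Equiv.swap i i'
  let σ2 := Equiv.swap (σ1 j) j'
  have h1 : σ1 i = i' := Equiv.swap_apply_left _ _
  have h1j : σ1 j ≠ i' := fun h => hij (σ1.injective (h1.trans h.symm))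
  have h1k : σ1 k ≠ i' := fun h => hik (σ1.injective (h1.trans h.symm))
  have h2 : σ2 (σ1 j) = j' := Equiv.swap_apply_left _ _
  have h2i : σ2 i' = i' := Equiv.swap_apply_of_ne_of_ne h1j.symm hij'
  have h2k : σ2 (σ1 k) ≠ j' := fun h => hjk (σ1.injective (σ2.injective (h2.trans h.symm)))
  have h2k' : σ2 (σ1 k) ≠ i' := fun h => h1k (σ2.injective (h.trans h2i.symm))
  refine ⟨(σ1.trans σ2).trans (Equiv.swap (σ2 (σ1 k)) k'), ?_, ?_, ?_⟩
  · simp only [Equiv.trans_apply, h1, h2i]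
    exact Equiv.swap_apply_of_ne_of_ne h2k'.symm hik'
  · simp only [Equiv.trans_apply, h2]
    exact Equiv.swap_apply_of_ne_of_ne h2k.symm hjk'
  · simp only [Equiv.trans_apply]
    exact Equiv.swap_apply_left _ _

/-- the case where the left triple contains a hyperbolic pair in its last two places,
and the right one has its first entry matching. -/
theorem pair (S : Sys f) (h2 : (2 : K) ≠ 0)
    (hc : ∀ i j k : Fin g, i ≠ j → i ≠ k → j ≠ k →
      f (va K i) (va K j) (va K k) (vb K i) (vb K j) (vb K k) = 0)
    (hd : ∀ i j k : Fin g, i ≠ j → i ≠ k → j ≠ k →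
      f (va K i) (va K j) (vb K j) (vb K i) (va K k) (vb K k) = 0)
    (hg : 3 ≤ g)
    (s1 s2 s3 t1 t2 t3 : Fin g ⊕ Fin g) (hs : s2 ≠ s3) (ht : t2 ≠ t3)
    (es : idx s2 = idx s3) (et : idx t2 = idx t3) (e1 : idx t1 = idx s1)
    (hs1 : idx s2 ≠ idx s1) (ht1 : idx t2 ≠ idx s1) :
    f (E K s1) (E K s2) (E K s3) (E K t1) (E K t2) (E K t3) = 0 := by
  apply S.red (idx s1) _ _ _ _ _ _ hs1 (es ▸ hs1) ht1 (et ▸ ht1) rfl e1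
  generalize idx s1 = i at *
  have key : ∀ j k : Fin g, j ≠ i → k ≠ i →
      f (va K i) (va K j) (vb K j) (vb K i) (va K k) (vb K k) = 0 := by
    intro j k hj hk
    by_cases hjk : j = k
    · subst hjk
      obtain ⟨l, hl⟩ : ∃ l : Fin g, l ∉ ({i, j} : Finset (Fin g)) := by
        by_contra! h
        have h3 : (Finset.univ : Finset (Fin g)).card ≤ ({i, j} : Finset (Fin g)).card :=
          Finset.card_le_card fun x _ => h x
        have h4 := Finset.card_le_two (a := i) (b := j)
        rw [Finset.card_univ, Fintype.card_fin] at h3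
        omega
      simp at hl
      exact S.rel h2 hc hd i j l hj.symm (Ne.symm hl.1) (Ne.symm hl.2)
    · exact hd i j k hj.symm hk.symm hjk
  rcases s2 with j | j <;> rcases s3 with j' | j' <;> rcases t2 with k | k <;>
    rcases t3 with k' | k' <;> simp [idx] at es et hs1 ht1 <;> subst es <;> subst et <;>
    first
    | exact absurd rfl hs
    | exact absurd rfl ht
    | exact key _ _ hs1 ht1
    | (rw [S.swp2, neg_eq_zero]; exact key _ _ hs1 ht1)
    | (rw [S.swp4, neg_eq_zero]; exact key _ _ hs1 ht1)
    | (rw [S.swp2, S.swp4, neg_neg]; exact key _ _ hs1 ht1)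

/-- pair, right triple arbitrary with `t1` matching -/
theorem pair2 (S : Sys f) (h2 : (2 : K) ≠ 0)
    (hc : ∀ i j k : Fin g, i ≠ j → i ≠ k → j ≠ k →
      f (va K i) (va K j) (va K k) (vb K i) (vb K j) (vb K k) = 0)
    (hd : ∀ i j k : Fin g, i ≠ j → i ≠ k → j ≠ k →
      f (va K i) (va K j) (vb K j) (vb K i) (va K k) (vb K k) = 0)
    (hg : 3 ≤ g)
    (s1 s2 s3 t1 t2 t3 : Fin g ⊕ Fin g) (hs : s2 ≠ s3) (ht : t2 ≠ t3) (ht12 : t1 ≠ t2)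
    (ht13 : t1 ≠ t3)
    (es : idx s2 = idx s3) (e1 : idx t1 = idx s1)
    (hs1 : idx s2 ≠ idx s1) :
    f (E K s1) (E K s2) (E K s3) (E K t1) (E K t2) (E K t3) = 0 := by
  have hs3 : idx s3 ≠ idx s1 := es ▸ hs1
  by_cases h1 : idx t2 = idx s1 <;> by_cases h3 : idx t3 = idx s1
  · exfalso
    have a := e1.trans h1.symm
    have b := e1.trans h3.symm
    rcases t1 with t1 | t1 <;> rcases t2 with t2 | t2 <;> rcases t3 with t3 | t3 <;>
      simp [idx] at a b <;> subst a <;> subst b <;> simp at ht ht12 ht13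
  · exact S.parity h2 (idx s1) _ _ _ _ _ _ (by simp [ep, e1, h1, h3, hs1, hs3])
  · exact S.parity h2 (idx s1) _ _ _ _ _ _ (by simp [ep, e1, h1, h3, hs1, hs3])
  by_cases h4 : idx t2 = idx t3
  · exact S.pair h2 hc hd hg _ _ _ _ _ _ hs ht es h4 e1 hs1 h1
  · refine S.parity h2 (idx t2) _ _ _ _ _ _ ?_
    by_cases h5 : idx s3 = idx t2
    · simp [ep, e1, Ne.symm h1, Ne.symm h4, es, h5]
    · simp [ep, e1, Ne.symm h1, Ne.symm h4, es, h5]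

theorem pair3 (S : Sys f) (h2 : (2 : K) ≠ 0)
    (hc : ∀ i j k : Fin g, i ≠ j → i ≠ k → j ≠ k →
      f (va K i) (va K j) (va K k) (vb K i) (vb K j) (vb K k) = 0)
    (hd : ∀ i j k : Fin g, i ≠ j → i ≠ k → j ≠ k →
      f (va K i) (va K j) (vb K j) (vb K i) (va K k) (vb K k) = 0)
    (hg : 3 ≤ g)
    (s1 s2 s3 t1 t2 t3 : Fin g ⊕ Fin g) (hs : s2 ≠ s3) (hs12 : s1 ≠ s2) (hs13 : s1 ≠ s3)
    (ht : t2 ≠ t3) (ht12 : t1 ≠ t2)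
    (ht13 : t1 ≠ t3) (es : idx s2 = idx s3) :
    f (E K s1) (E K s2) (E K s3) (E K t1) (E K t2) (E K t3) = 0 := by
  have hs1 : idx s2 ≠ idx s1 := by
    intro h
    rcases s1 with t1 | t1 <;> rcases s2 with t2 | t2 <;> rcases s3 with t3 | t3 <;>
      simp [idx] at es h <;> subst es <;> subst h <;> simp at hs hs12 hs13
  have hs3 : idx s3 ≠ idx s1 := es ▸ hs1
  by_cases h1 : idx t1 = idx s1
  · exact S.pair2 h2 hc hd hg _ _ _ _ _ _ hs ht ht12 ht13 es h1 hs1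
  by_cases h3 : idx t2 = idx s1
  · rw [S.swp3, neg_eq_zero]
    exact S.pair2 h2 hc hd hg _ _ _ _ _ _ hs ht13 ht12.symm ht es h3 hs1
  by_cases h4 : idx t3 = idx s1
  · rw [S.swp4, S.swp3, neg_neg]
    exact S.pair2 h2 hc hd hg _ _ _ _ _ _ hs ht12 ht13.symm ht.symm es h4 hs1
  exact S.parity h2 (idx s1) _ _ _ _ _ _ (by simp [ep, h1, h3, h4, hs1, hs3])

theorem main (S : Sys f) (h2 : (2 : K) ≠ 0) (i j k : Fin g) (hij : i ≠ j) (hik : i ≠ k)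
    (hjk : j ≠ k) (hc : f (va K i) (va K j) (va K k) (vb K i) (vb K j) (vb K k) = 0)
    (hd : f (va K i) (va K j) (vb K j) (vb K i) (va K k) (vb K k) = 0) (hg : 3 ≤ g)
    (s1 s2 s3 t1 t2 t3 : Fin g ⊕ Fin g) (hs : s2 ≠ s3) (hs12 : s1 ≠ s2) (hs13 : s1 ≠ s3)
    (ht : t2 ≠ t3) (ht12 : t1 ≠ t2) (ht13 : t1 ≠ t3) :
    f (E K s1) (E K s2) (E K s3) (E K t1) (E K t2) (E K t3) = 0 := by
  replace hc : ∀ i j k : Fin g, i ≠ j → i ≠ k → j ≠ k →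
      f (va K i) (va K j) (va K k) (vb K i) (vb K j) (vb K k) = 0 := by
    intro i' j' k' hij' hik' hjk'
    obtain ⟨σ, rfl, rfl, rfl⟩ := exists_perm hij hik hjk hij' hik' hjk'
    have := S.inv (prm σ) (prm_pres σ) (va K i) (va K j) (va K k) (vb K i) (vb K j) (vb K k)
    rw [hc] at this
    simpa only [prm_a, prm_b] using this
  replace hd : ∀ i j k : Fin g, i ≠ j → i ≠ k → j ≠ k →
      f (va K i) (va K j) (vb K j) (vb K i) (va K k) (vb K k) = 0 := by
    intro i' j' k' hij' hik' hjk'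
    obtain ⟨σ, rfl, rfl, rfl⟩ := exists_perm hij hik hjk hij' hik' hjk'
    have := S.inv (prm σ) (prm_pres σ) (va K i) (va K j) (vb K j) (vb K i) (va K k) (vb K k)
    rw [hd] at this
    simpa only [prm_a, prm_b] using this
  by_cases h23 : idx s2 = idx s3
  · exact S.pair3 h2 hc hd hg _ _ _ _ _ _ hs hs12 hs13 ht ht12 ht13 h23
  by_cases h13 : idx s1 = idx s3
  · rw [S.swp1, neg_eq_zero]
    exact S.pair3 h2 hc hd hg _ _ _ _ _ _ hs13 hs12.symm hs ht ht12 ht13 h13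
  by_cases h12 : idx s1 = idx s2
  · rw [S.swp2, S.swp1, neg_neg]
    exact S.pair3 h2 hc hd hg _ _ _ _ _ _ hs12 hs13.symm hs.symm ht ht12 ht13 h12
  have m1 : (idx t1 = idx s1 ∨ idx t2 = idx s1 ∨ idx t3 = idx s1) ∨
      f (E K s1) (E K s2) (E K s3) (E K t1) (E K t2) (E K t3) = 0 := by
    by_contra! h
    exact h.2 (S.parity h2 (idx s1) _ _ _ _ _ _ (by simp [ep, h.1, Ne.symm h12, Ne.symm h13]))
  have m2 : (idx t1 = idx s2 ∨ idx t2 = idx s2 ∨ idx t3 = idx s2) ∨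
      f (E K s1) (E K s2) (E K s3) (E K t1) (E K t2) (E K t3) = 0 := by
    by_contra! h
    exact h.2 (S.parity h2 (idx s2) _ _ _ _ _ _ (by simp [ep, h.1, h12, Ne.symm h23]))
  have m3 : (idx t1 = idx s3 ∨ idx t2 = idx s3 ∨ idx t3 = idx s3) ∨
      f (E K s1) (E K s2) (E K s3) (E K t1) (E K t2) (E K t3) = 0 := by
    by_contra! h
    exact h.2 (S.parity h2 (idx s3) _ _ _ _ _ _ (by simp [ep, h.1, h13, h23]))
  have L := fun t1 t2 t3 => S.L1 hc s1 s2 s3 t1 t2 t3 h12 h13 h23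
  rcases m1 with m1 | m1
  swap
  · exact m1
  rcases m2 with m2 | m2
  swap
  · exact m2
  rcases m3 with m3 | m3
  swap
  · exact m3
  rcases m1 with m1 | m1 | m1 <;> rcases m2 with m2 | m2 | m2 <;> rcases m3 with m3 | m3 | m3 <;>
    first
    | exact absurd (m1.symm.trans m2) h12
    | exact absurd (m1.symm.trans m3) h13
    | exact absurd (m2.symm.trans m3) h23
    | exact L _ _ _ m1 m2 m3
    | (rw [S.swp3, neg_eq_zero]; exact L _ _ _ m1 m2 m3)
    | (rw [S.swp4, neg_eq_zero]; exact L _ _ _ m1 m2 m3)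
    | (rw [S.swp3, S.swp4, neg_neg]; exact L _ _ _ m1 m2 m3)
    | (rw [S.swp4, S.swp3, neg_neg]; exact L _ _ _ m1 m2 m3)
    | (rw [S.swp3, S.swp4, S.swp3, neg_neg, neg_eq_zero]; exact L _ _ _ m1 m2 m3)

end Sys
end
end SpInv
namespace SpInv
section
variable {K : Type*} [Field K] {g : ℕ}
open exteriorPower

theorem extPowerMap_eq (φ : VV K g →ₗ[K] VV K g) :
    extPowerMap 3 φ = exteriorPower.map 3 φ := by
  apply exteriorPower.linearMap_ext
  ext v : 1
  apply Subtype.ext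
  simp only [LinearMap.compAlternatingMap_apply, exteriorPower.map_apply_ιMulti,
    exteriorPower.ιMulti_apply_coe]
  exact ExteriorAlgebra.map_apply_ιMulti φ v

theorem ext_wedge {D D' : (⋀[K]^3 (VV K g)) →ₗ[K] (⋀[K]^3 (VV K g)) →ₗ[K] K}
    (h : ∀ v w : Fin 3 → VV K g, D (ιMulti K 3 v) (ιMulti K 3 w) = D' (ιMulti K 3 v) (ιMulti K 3 w)) :
    D = D' := by
  apply exteriorPower.linearMap_ext
  ext v : 1
  apply exteriorPower.linearMap_ext
  ext w : 1
  exact h v w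

theorem upd {X : Type*} (inst : DecidableEq (Fin 3)) (v : Fin 3 → X) :
    (∀ x, @Function.update _ _ inst v 0 x = ![x, v 1, v 2]) ∧
    (∀ x, @Function.update _ _ inst v 1 x = ![v 0, x, v 2]) ∧
    (∀ x, @Function.update _ _ inst v 2 x = ![v 0, v 1, x]) := by
  obtain rfl : inst = instDecidableEqFin 3 := Subsingleton.elim _ _
  refine ⟨?_, ?_, ?_⟩ <;> intro x <;> ext i : 1 <;> fin_cases i <;> rfl

/-- contraction as an alternating map -/
noncomputable def contrAlt (K : Type*) [Field K] (g : ℕ) : VV K g [⋀^Fin 3]→ₗ[K] VV K g where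
  toFun v := om K g (v 0) (v 1) • v 2 + om K g (v 1) (v 2) • v 0 + om K g (v 2) (v 0) • v 1
  map_update_add' := by
    intro inst v i x y
    obtain ⟨e0, e1, e2⟩ := upd inst v
    have hi : i = 0 ∨ i = 1 ∨ i = 2 := by omega
    rcases hi with rfl | rfl | rfl <;> simp only [e0, e1, e2, Matrix.cons_val, map_add, map_smul,
      LinearMap.add_apply, LinearMap.smul_apply, smul_eq_mul] <;> module
  map_update_smul' := by
    intro inst v i c x
    obtain ⟨e0, e1, e2⟩ := upd inst v
    have hi : i = 0 ∨ i = 1 ∨ i = 2 := by omega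
    rcases hi with rfl | rfl | rfl <;> simp only [e0, e1, e2, Matrix.cons_val, map_add, map_smul,
      LinearMap.add_apply, LinearMap.smul_apply, smul_eq_mul] <;> module
  map_eq_zero_of_eq' := by
    intro v i j h hij
    have key : ∀ x y : VV K g, om K g x y • x + om K g y x • x = 0 := by
      intro x y; rw [om_swap y x]; module
    fin_cases i <;> fin_cases j <;> simp at hij h <;> simp only [h, om_self] <;>
      (try rw [om_swap (v 1) (v 2)]) <;> (try rw [om_swap (v 2) (v 0)]) <;>
      (try rw [om_swap (v 0) (v 1)]) <;> simp

/-- contraction `⋀³ → H` -/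
noncomputable def contr (K : Type*) [Field K] (g : ℕ) : (⋀[K]^3 (VV K g)) →ₗ[K] VV K g :=
  alternatingMapLinearEquiv (contrAlt K g)

theorem contr_apply (v : Fin 3 → VV K g) : contr K g (ιMulti K 3 v) =
    om K g (v 0) (v 1) • v 2 + om K g (v 1) (v 2) • v 0 + om K g (v 2) (v 0) • v 1 := by
  rw [contr, alternatingMapLinearEquiv_apply_ιMulti]; rfl

/-- first form -/
noncomputable def kap (K : Type*) [Field K] (g : ℕ) :
    (⋀[K]^3 (VV K g)) →ₗ[K] (⋀[K]^3 (VV K g)) →ₗ[K] K :=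
  (om K g).compl₁₂ (contr K g) (contr K g)

/-- second form -/
noncomputable def the (K : Type*) [Field K] (g : ℕ) :
    (⋀[K]^3 (VV K g)) →ₗ[K] (⋀[K]^3 (VV K g)) →ₗ[K] K :=
  (pairingDual K (VV K g) 3) ∘ₗ (exteriorPower.map 3 (om K g))

theorem the_apply (v w : Fin 3 → VV K g) : the K g (ιMulti K 3 v) (ιMulti K 3 w) =
    Matrix.det (Matrix.of (fun i j => om K g (v j) (w i))) := by
  rw [the, LinearMap.comp_apply, exteriorPower.map_apply_ιMulti]
  exact pairingDual_ιMulti_ιMulti _ _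

theorem kap_alt (u : ⋀[K]^3 (VV K g)) : kap K g u u = 0 := om_self _

theorem the_alt (h2 : (2 : K) ≠ 0) (u : ⋀[K]^3 (VV K g)) : the K g u u = 0 := by
  have h : the K g = - (the K g).flip := by
    apply ext_wedge
    intro v w
    simp only [LinearMap.neg_apply, LinearMap.flip_apply, the_apply]
    have : (Matrix.of (fun i j => om K g (w j) (v i))) =
        - (Matrix.of (fun i j => om K g (v j) (w i)))ᵀ := by
      ext i j; simp [om_swap (w j) (v i)]
    rw [this, Matrix.det_neg, Matrix.det_transpose]
    simp; ring
  have h' := congrArg (fun F => F u u) h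
  simp only [LinearMap.neg_apply, LinearMap.flip_apply] at h'
  exact Sys.eq_zero_of_neg h2 h'.symm

theorem kap_inv (φ : VV K g →ₗ[K] VV K g) (hφ : ∀ x y, om K g (φ x) (φ y) = om K g x y) (u v) :
    kap K g (exteriorPower.map 3 φ u) (exteriorPower.map 3 φ v) = kap K g u v := by
  have h : (kap K g).compl₁₂ (exteriorPower.map 3 φ) (exteriorPower.map 3 φ) = kap K g := by
    apply ext_wedge
    intro v w
    simp only [LinearMap.compl₁₂_apply, exteriorPower.map_apply_ιMulti, kap, contr_apply,
      Function.comp_apply, hφ, ← map_smul, ← map_add]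
  exact congrArg (fun F => F u v) h

theorem the_inv (φ : VV K g →ₗ[K] VV K g) (hφ : ∀ x y, om K g (φ x) (φ y) = om K g x y) (u v) :
    the K g (exteriorPower.map 3 φ u) (exteriorPower.map 3 φ v) = the K g u v := by
  have h : (the K g).compl₁₂ (exteriorPower.map 3 φ) (exteriorPower.map 3 φ) = the K g := by
    apply ext_wedge
    intro v w
    simp only [LinearMap.compl₁₂_apply, exteriorPower.map_apply_ιMulti, the_apply,
      Function.comp_apply, hφ]
  exact congrArg (fun F => F u v) h

theorem sys_of (D : (⋀[K]^3 (VV K g)) →ₗ[K] (⋀[K]^3 (VV K g)) →ₗ[K] K)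
    (h0 : ∀ u, D u u = 0)
    (hinv : ∀ φ : VV K g →ₗ[K] VV K g, (∀ x y, om K g (φ x) (φ y) = om K g x y) →
      ∀ u v, D (exteriorPower.map 3 φ u) (exteriorPower.map 3 φ v) = D u v) :
    Sys (fun x1 x2 x3 y1 y2 y3 => D (ιMulti K 3 ![x1, x2, x3]) (ιMulti K 3 ![y1, y2, y3])) where
  add1 x x' x2 x3 y1 y2 y3 := by
    have := (ιMulti K 3 (M := VV K g)).map_update_add ![x, x2, x3] 0 x x'
    have e : ∀ y, Function.update ![x, x2, x3] 0 y = ![y, x2, x3] := by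
      intro y; ext i : 1; fin_cases i <;> rfl
    rw [e, e, e] at this
    simp only [this, map_add, LinearMap.add_apply]
  neg1 x x2 x3 y1 y2 y3 := by
    have := (ιMulti K 3 (M := VV K g)).map_update_neg ![x, x2, x3] 0 x
    have e : ∀ y, Function.update ![x, x2, x3] 0 y = ![y, x2, x3] := by
      intro y; ext i : 1; fin_cases i <;> rfl
    rw [e, e] at this
    simp only [this, map_neg, LinearMap.neg_apply]
  swp1 x1 x2 x3 y1 y2 y3 := by
    have := (ιMulti K 3 (M := VV K g)).map_swap ![x1, x2, x3] (show (0 : Fin 3) ≠ 1 by decide)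
    have e : ![x1, x2, x3] ∘ Equiv.swap (0 : Fin 3) 1 = ![x2, x1, x3] := by
      ext i : 1; fin_cases i <;> rfl
    rw [e] at this
    simp [this]
  swp2 x1 x2 x3 y1 y2 y3 := by
    have := (ιMulti K 3 (M := VV K g)).map_swap ![x1, x2, x3] (show (1 : Fin 3) ≠ 2 by decide)
    have e : ![x1, x2, x3] ∘ Equiv.swap (1 : Fin 3) 2 = ![x1, x3, x2] := by
      ext i : 1; fin_cases i <;> rfl
    rw [e] at this
    simp [this]
  lr x1 x2 x3 y1 y2 y3 := by
    have h := h0 (ιMulti K 3 ![x1, x2, x3] + ιMulti K 3 ![y1, y2, y3])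
    simp only [map_add, LinearMap.add_apply, h0] at h
    linear_combination h
  inv φ hφ x1 x2 x3 y1 y2 y3 := by
    have h := hinv φ hφ (ιMulti K 3 ![x1, x2, x3]) (ιMulti K 3 ![y1, y2, y3])
    have e : ∀ a b c : VV K g, φ ∘ ![a, b, c] = ![φ a, φ b, φ c] := by
      intro a b c; ext i : 1; fin_cases i <;> rfl
    rw [exteriorPower.map_apply_ιMulti, exteriorPower.map_apply_ιMulti, e, e] at h
    exact h

theorem inv_iff (B : (⋀[K]^3 (VV K g)) →ₗ[K] (⋀[K]^3 (VV K g)) →ₗ[K] K) :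
    (∀ M : Matrix (Fin g ⊕ Fin g) (Fin g ⊕ Fin g) K,
        M * OmegaMat g K * Mᵀ = OmegaMat g K →
        ∀ u v, B (extPowerMap 3 (Matrix.toLin' M) u) (extPowerMap 3 (Matrix.toLin' M) v) =
          B u v) ↔
    (∀ φ : VV K g →ₗ[K] VV K g, (∀ x y, om K g (φ x) (φ y) = om K g x y) →
      ∀ u v, B (exteriorPower.map 3 φ u) (exteriorPower.map 3 φ v) = B u v) := by
  constructor
  · intro h φ hφ u v
    have := h (LinearMap.toMatrix' φ) ((omega_iff _).2 fun x y => by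
      rw [← Matrix.toLin'_apply, ← Matrix.toLin'_apply, Matrix.toLin'_toMatrix', hφ]) u v
    rwa [Matrix.toLin'_toMatrix', extPowerMap_eq] at this
  · intro h M hM u v
    rw [extPowerMap_eq]
    exact h _ (fun x y => by
      rw [Matrix.toLin'_apply, Matrix.toLin'_apply]; exact (omega_iff M).1 hM x y) u v

theorem eq_zero_of (h2 : (2 : K) ≠ 0) (hg : 3 ≤ g)
    (D : (⋀[K]^3 (VV K g)) →ₗ[K] (⋀[K]^3 (VV K g)) →ₗ[K] K)
    (h0 : ∀ u, D u u = 0)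
    (hinv : ∀ φ : VV K g →ₗ[K] VV K g, (∀ x y, om K g (φ x) (φ y) = om K g x y) →
      ∀ u v, D (exteriorPower.map 3 φ u) (exteriorPower.map 3 φ v) = D u v)
    (i j k : Fin g) (hij : i ≠ j) (hik : i ≠ k) (hjk : j ≠ k)
    (hc : D (ιMulti K 3 ![va K i, va K j, va K k]) (ιMulti K 3 ![vb K i, vb K j, vb K k]) = 0)
    (hd : D (ιMulti K 3 ![va K i, va K j, vb K j]) (ιMulti K 3 ![vb K i, va K k, vb K k]) = 0) :
    D = 0 := by
  have S := sys_of D h0 hinv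
  have e3 : ∀ s : Fin 3 → Fin g ⊕ Fin g,
      (fun l => Pi.basisFun K (Fin g ⊕ Fin g) (s l)) = ![E K (s 0), E K (s 1), E K (s 2)] := by
    intro s; ext l : 1
    fin_cases l <;> simp [E]
  apply exteriorPower.linearMap_ext
  apply (Pi.basisFun K (Fin g ⊕ Fin g)).ext_alternating
  intro s hs
  apply exteriorPower.linearMap_ext
  apply (Pi.basisFun K (Fin g ⊕ Fin g)).ext_alternating
  intro t ht
  simp only [LinearMap.compAlternatingMap_apply, e3]
  have := S.main h2 i j k hij hik hjk hc hd hg (s 0) (s 1) (s 2) (t 0) (t 1) (t 2)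
    (hs.ne (by decide)) (hs.ne (by decide)) (hs.ne (by decide))
    (ht.ne (by decide)) (ht.ne (by decide)) (ht.ne (by decide))
  simpa using this

end
end SpInv

theorem card_sp_invariant_alternating_forms (p g : ℕ) (hp : p.Prime) (hodd : Odd p)
    (hg : 4 ≤ g) :
    Nat.card {B : (⋀[ZMod p]^3 ((Fin g ⊕ Fin g) → ZMod p)) →ₗ[ZMod p]
        (⋀[ZMod p]^3 ((Fin g ⊕ Fin g) → ZMod p)) →ₗ[ZMod p] ZMod p //
      (∀ u, B u u = 0) ∧
      ∀ M : Matrix (Fin g ⊕ Fin g) (Fin g ⊕ Fin g) (ZMod p),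
        M * OmegaMat g (ZMod p) * Mᵀ = OmegaMat g (ZMod p) →
        ∀ u v, B (extPowerMap 3 (Matrix.toLin' M) u) (extPowerMap 3 (Matrix.toLin' M) v) =
          B u v} = p ^ 2 := by
  haveI : Fact p.Prime := ⟨hp⟩
  have h2 : (2 : ZMod p) ≠ 0 := by
    intro h
    have h' : ((2 : ℕ) : ZMod p) = 0 := by exact_mod_cast h
    rw [ZMod.natCast_eq_zero_iff] at h'
    have := (Nat.prime_dvd_prime_iff_eq hp Nat.prime_two).1 h'
    subst this
    exact absurd hodd (by decide)
  simp only [SpInv.inv_iff]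
  let i : Fin g := ⟨0, by omega⟩
  let j : Fin g := ⟨1, by omega⟩
  let k : Fin g := ⟨2, by omega⟩
  have hij : i ≠ j := by simp [i, j]
  have hik : i ≠ k := by simp [i, k]
  have hjk : j ≠ k := by simp [j, k]
  let w : SpInv.VV (ZMod p) g → SpInv.VV (ZMod p) g → SpInv.VV (ZMod p) g →
      (⋀[ZMod p]^3 (SpInv.VV (ZMod p) g)) := fun x y z => exteriorPower.ιMulti (ZMod p) 3 ![x, y, z]
  let a : Fin g → SpInv.VV (ZMod p) g := SpInv.va (ZMod p)
  let b : Fin g → SpInv.VV (ZMod p) g := SpInv.vb (ZMod p)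
  let ev : _ → ZMod p × ZMod p := fun B : {B : (⋀[ZMod p]^3 (SpInv.VV (ZMod p) g)) →ₗ[ZMod p]
        (⋀[ZMod p]^3 (SpInv.VV (ZMod p) g)) →ₗ[ZMod p] ZMod p //
      (∀ u, B u u = 0) ∧
      ∀ φ : SpInv.VV (ZMod p) g →ₗ[ZMod p] SpInv.VV (ZMod p) g,
        (∀ x y, SpInv.om (ZMod p) g (φ x) (φ y) = SpInv.om (ZMod p) g x y) →
        ∀ u v, B (exteriorPower.map 3 φ u) (exteriorPower.map 3 φ v) = B u v} =>
    (B.1 (w (a i) (a j) (a k)) (w (b i) (b j) (b k)), B.1 (w (a i) (a j) (b j)) (w (b i) (a k) (b k)))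
  have hev : Function.Bijective ev := by
    constructor
    · rintro ⟨B, hB0, hB⟩ ⟨B', hB0', hB'⟩ h
      obtain ⟨h1, h3⟩ := Prod.mk.inj h
      apply Subtype.ext
      rw [← sub_eq_zero]
      refine SpInv.eq_zero_of h2 (by omega) _ ?_ ?_ i j k hij hik hjk ?_ ?_
      · intro u; simp [hB0, hB0']
      · intro φ hφ u v; simp [hB φ hφ, hB' φ hφ]
      · simpa [sub_eq_zero] using h1
      · simpa [sub_eq_zero] using h3
    · rintro ⟨c, d⟩
      refine ⟨⟨c • SpInv.the (ZMod p) g + d • SpInv.kap (ZMod p) g, ?_, ?_⟩, ?_⟩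
      · intro u; simp [SpInv.the_alt h2, SpInv.kap_alt]
      · intro φ hφ u v; simp [SpInv.the_inv φ hφ, SpInv.kap_inv φ hφ]
      · have t1 : SpInv.the (ZMod p) g (w (a i) (a j) (a k)) (w (b i) (b j) (b k)) = 1 := by
          simp only [w, SpInv.the_apply, Matrix.det_fin_three]
          simp [a, b, hij, hik, hjk, hij.symm, hik.symm, hjk.symm]
        have t2 : SpInv.the (ZMod p) g (w (a i) (a j) (b j)) (w (b i) (a k) (b k)) = 0 := by
          simp only [w, SpInv.the_apply, Matrix.det_fin_three]
          simp [a, b, hij, hik, hjk, hij.symm, hik.symm, hjk.symm]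
        have k1 : SpInv.kap (ZMod p) g (w (a i) (a j) (a k)) (w (b i) (b j) (b k)) = 0 := by
          simp only [w, SpInv.kap, LinearMap.compl₁₂_apply, SpInv.contr_apply]
          simp [a, b, hij, hik, hjk, hij.symm, hik.symm, hjk.symm]
        have k2 : SpInv.kap (ZMod p) g (w (a i) (a j) (b j)) (w (b i) (a k) (b k)) = 1 := by
          simp only [w, SpInv.kap, LinearMap.compl₁₂_apply, SpInv.contr_apply]
          simp [a, b, hij, hik, hjk, hij.symm, hik.symm, hjk.symm]
        simp only [ev, LinearMap.add_apply, LinearMap.smul_apply, t1, t2, k1, k2]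
        simp
  refine (Nat.card_congr (Equiv.ofBijective ev hev)).trans ?_
  rw [Nat.card_prod, Nat.card_zmod, sq]
end
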